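/- Let (B₁, B₂, μ_l, ν_l, μ_r, ν_r) be a Hopf datum and set φ₁₂ := (m₂ ⊗ m₁) ∘ (id ⊗ τ ⊗ id) ∘ (ν_l ⊗ ν_r) : B₁ ⊗ B₂ → B₂ ⊗ B₁. Then B := B₁ ⊗ B₂ with comultiplication Δ_B := (id ⊗ φ₁₂ ⊗ id) ∘ (Δ₁ ⊗ Δ₂) and counit ε₁ ⊗ ε₂ is a coassociative counital coalgebra. -/

import Mathlib

open TensorProduct
open scoped TensorProduct

set_option maxHeartbeats 1000000
set_option linter.unusedVariables false

namespace CPB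

section Combinators
variable {k : Type*} [CommRing k]
variable {A B C D R R' : Type*}
  [AddCommMonoid A] [Module k A] [AddCommMonoid B] [Module k B]
  [AddCommMonoid C] [Module k C] [AddCommMonoid D] [Module k D]
  [AddCommMonoid R] [Module k R] [AddCommMonoid R'] [Module k R']

/-- apply a map to the tail of a right-nested tensor product -/
noncomputable def skp (g : R →ₗ[k] R') : (A ⊗[k] R) →ₗ[k] (A ⊗[k] R') :=
  TensorProduct.map LinearMap.id g

/-- apply a two-strand operation to the first two strands -/
noncomputable def pair2 (op : (A ⊗[k] B) →ₗ[k] (C ⊗[k] D)) :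
    (A ⊗[k] (B ⊗[k] R)) →ₗ[k] (C ⊗[k] (D ⊗[k] R)) :=
  (TensorProduct.assoc k C D R).toLinearMap ∘ₗ
    TensorProduct.map op LinearMap.id ∘ₗ (TensorProduct.assoc k A B R).symm.toLinearMap

/-- multiply the first two strands together -/
noncomputable def merge2 (m : (A ⊗[k] B) →ₗ[k] C) :
    (A ⊗[k] (B ⊗[k] R)) →ₗ[k] (C ⊗[k] R) :=
  TensorProduct.map m LinearMap.id ∘ₗ (TensorProduct.assoc k A B R).symm.toLinearMap

/-- split the first strand in two -/
noncomputable def split2 (d : A →ₗ[k] (C ⊗[k] D)) :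
    (A ⊗[k] R) →ₗ[k] (C ⊗[k] (D ⊗[k] R)) :=
  (TensorProduct.assoc k C D R).toLinearMap ∘ₗ TensorProduct.map d LinearMap.id

/-- transpose the first two strands -/
noncomputable def swap2 : (A ⊗[k] (B ⊗[k] R)) →ₗ[k] (B ⊗[k] (A ⊗[k] R)) :=
  pair2 (TensorProduct.comm k A B).toLinearMap

/-- pair the two first strands off into a scalar -/
noncomputable def payL (p : (A ⊗[k] B) →ₗ[k] k) :
    (A ⊗[k] (B ⊗[k] R)) →ₗ[k] R :=
  (TensorProduct.lid k R).toLinearMap ∘ₗ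
    TensorProduct.map p LinearMap.id ∘ₗ (TensorProduct.assoc k A B R).symm.toLinearMap

end Combinators

section Apply4
variable {k : Type*} [CommRing k] {B1 B2 R : Type*}
  [AddCommMonoid B1] [Module k B1] [AddCommMonoid B2] [Module k B2]
  [AddCommMonoid R] [Module k R]

/-- apply an endomorphism of the four-fold tensor product to the first four strands -/
noncomputable def apply4
    (f : (B1 ⊗[k] (B2 ⊗[k] (B1 ⊗[k] B2))) →ₗ[k] (B1 ⊗[k] (B2 ⊗[k] (B1 ⊗[k] B2)))) :
    (B1 ⊗[k] (B2 ⊗[k] (B1 ⊗[k] (B2 ⊗[k] R)))) →ₗ[k]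
      (B1 ⊗[k] (B2 ⊗[k] (B1 ⊗[k] (B2 ⊗[k] R)))) :=
  letI E : ((B1 ⊗[k] (B2 ⊗[k] (B1 ⊗[k] B2))) ⊗[k] R) ≃ₗ[k]
      (B1 ⊗[k] (B2 ⊗[k] (B1 ⊗[k] (B2 ⊗[k] R)))) :=
    (TensorProduct.assoc k B1 (B2 ⊗[k] (B1 ⊗[k] B2)) R) ≪≫ₗ
      TensorProduct.congr (LinearEquiv.refl k B1)
        ((TensorProduct.assoc k B2 (B1 ⊗[k] B2) R) ≪≫ₗ
          TensorProduct.congr (LinearEquiv.refl k B2) (TensorProduct.assoc k B1 B2 R))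
  E.toLinearMap ∘ₗ TensorProduct.map f LinearMap.id ∘ₗ E.symm.toLinearMap

end Apply4

section Structures
variable (k : Type*) [CommRing k] (M : Type*) [AddCommMonoid M] [Module k M]

/-- `(M, mul, unit)` is an associative unital algebra (in terms of linear maps). -/
structure IsAlgMaps (mul : (M ⊗[k] M) →ₗ[k] M) (unit : k →ₗ[k] M) : Prop where
  mul_assoc :
    mul ∘ₗ TensorProduct.map mul LinearMap.id =
      mul ∘ₗ TensorProduct.map LinearMap.id mul ∘ₗ (TensorProduct.assoc k M M M).toLinearMap
  one_mul :
    mul ∘ₗ TensorProduct.map unit LinearMap.id ∘ₗ (TensorProduct.lid k M).symm.toLinearMap =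
      LinearMap.id
  mul_one :
    mul ∘ₗ TensorProduct.map LinearMap.id unit ∘ₗ (TensorProduct.rid k M).symm.toLinearMap =
      LinearMap.id

/-- `(M, comul, counit)` is a coassociative counital coalgebra (in terms of linear maps). -/
structure IsCoalgMaps (comul : M →ₗ[k] (M ⊗[k] M)) (counit : M →ₗ[k] k) : Prop where
  coassoc :
    (TensorProduct.assoc k M M M).toLinearMap ∘ₗ TensorProduct.map comul LinearMap.id ∘ₗ comul =
      TensorProduct.map LinearMap.id comul ∘ₗ comul
  counit_left :
    (TensorProduct.lid k M).toLinearMap ∘ₗ TensorProduct.map counit LinearMap.id ∘ₗ comul =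
      LinearMap.id
  counit_right :
    (TensorProduct.rid k M).toLinearMap ∘ₗ TensorProduct.map LinearMap.id counit ∘ₗ comul =
      LinearMap.id

/-- the given structure maps make `M` a bialgebra. -/
structure IsBialgebraMaps (mul : (M ⊗[k] M) →ₗ[k] M) (unit : k →ₗ[k] M)
    (comul : M →ₗ[k] (M ⊗[k] M)) (counit : M →ₗ[k] k) : Prop where
  alg : IsAlgMaps k M mul unit
  coalg : IsCoalgMaps k M comul counit
  comul_mul :
    comul ∘ₗ mul =
      TensorProduct.map mul mul ∘ₗ (TensorProduct.tensorTensorTensorComm k M M M M).toLinearMap ∘ₗ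
        TensorProduct.map comul comul
  counit_mul :
    counit ∘ₗ mul = LinearMap.mul' k k ∘ₗ TensorProduct.map counit counit
  comul_unit :
    comul ∘ₗ unit = TensorProduct.map unit unit ∘ₗ (TensorProduct.lid k k).symm.toLinearMap
  counit_unit : counit ∘ₗ unit = LinearMap.id

/-- an object which is simultaneously an algebra and a coalgebra. -/
structure ACData where
  mul : (M ⊗[k] M) →ₗ[k] M
  unit : k →ₗ[k] M
  comul : M →ₗ[k] (M ⊗[k] M)
  counit : M →ₗ[k] k
  alg : IsAlgMaps k M mul unit
  coalg : IsCoalgMaps k M comul counit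

end Structures

section Cross
variable {k : Type*} [CommRing k] {B1 B2 : Type*}
  [AddCommMonoid B1] [Module k B1] [AddCommMonoid B2] [Module k B2]

/-- the multiplication `(m₁ ⊗ m₂) ∘ (id ⊗ φ₂₁ ⊗ id)` of a would-be cross product bialgebra -/
noncomputable def crossMul (m1 : (B1 ⊗[k] B1) →ₗ[k] B1) (m2 : (B2 ⊗[k] B2) →ₗ[k] B2)
    (phi21 : (B2 ⊗[k] B1) →ₗ[k] (B1 ⊗[k] B2)) :
    ((B1 ⊗[k] B2) ⊗[k] (B1 ⊗[k] B2)) →ₗ[k] (B1 ⊗[k] B2) :=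
  ((skp m2) : (B1 ⊗[k] (B2 ⊗[k] B2)) →ₗ[k] (B1 ⊗[k] B2))
    ∘ₗ ((merge2 m1) : (B1 ⊗[k] (B1 ⊗[k] (B2 ⊗[k] B2))) →ₗ[k] (B1 ⊗[k] (B2 ⊗[k] B2)))
    ∘ₗ ((skp (pair2 phi21)) : (B1 ⊗[k] (B2 ⊗[k] (B1 ⊗[k] B2))) →ₗ[k]
        (B1 ⊗[k] (B1 ⊗[k] (B2 ⊗[k] B2))))
    ∘ₗ (TensorProduct.assoc k B1 B2 (B1 ⊗[k] B2)).toLinearMap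

/-- the unit `η₁ ⊗ η₂` of a would-be cross product bialgebra -/
noncomputable def crossUnit (eta1 : k →ₗ[k] B1) (eta2 : k →ₗ[k] B2) :
    k →ₗ[k] (B1 ⊗[k] B2) :=
  TensorProduct.map eta1 eta2 ∘ₗ (TensorProduct.lid k k).symm.toLinearMap

/-- the comultiplication `(id ⊗ φ₁₂ ⊗ id) ∘ (Δ₁ ⊗ Δ₂)` of a would-be cross product bialgebra -/
noncomputable def crossComul (delta1 : B1 →ₗ[k] (B1 ⊗[k] B1)) (delta2 : B2 →ₗ[k] (B2 ⊗[k] B2))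
    (phi12 : (B1 ⊗[k] B2) →ₗ[k] (B2 ⊗[k] B1)) :
    (B1 ⊗[k] B2) →ₗ[k] ((B1 ⊗[k] B2) ⊗[k] (B1 ⊗[k] B2)) :=
  (TensorProduct.assoc k B1 B2 (B1 ⊗[k] B2)).symm.toLinearMap
    ∘ₗ ((skp (pair2 phi12)) : (B1 ⊗[k] (B1 ⊗[k] (B2 ⊗[k] B2))) →ₗ[k]
        (B1 ⊗[k] (B2 ⊗[k] (B1 ⊗[k] B2))))
    ∘ₗ ((skp (skp delta2)) : (B1 ⊗[k] (B1 ⊗[k] B2)) →ₗ[k] (B1 ⊗[k] (B1 ⊗[k] (B2 ⊗[k] B2))))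
    ∘ₗ ((split2 delta1) : (B1 ⊗[k] B2) →ₗ[k] (B1 ⊗[k] (B1 ⊗[k] B2)))

/-- the counit `ε₁ ⊗ ε₂` of a would-be cross product bialgebra -/
noncomputable def crossCounit (eps1 : B1 →ₗ[k] k) (eps2 : B2 →ₗ[k] k) :
    (B1 ⊗[k] B2) →ₗ[k] k :=
  LinearMap.mul' k k ∘ₗ TensorProduct.map eps1 eps2

end Cross


section HopfDatumSection
variable (k : Type*) [CommRing k] (B1 B2 : Type*)
  [AddCommMonoid B1] [Module k B1] [AddCommMonoid B2] [Module k B2]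

noncomputable def ax_actL_act (m1 : (B1 ⊗[k] B1) →ₗ[k] B1) (eta1 : k →ₗ[k] B1)
    (delta1 : B1 →ₗ[k] (B1 ⊗[k] B1)) (eps1 : B1 →ₗ[k] k)
    (m2 : (B2 ⊗[k] B2) →ₗ[k] B2) (eta2 : k →ₗ[k] B2)
    (delta2 : B2 →ₗ[k] (B2 ⊗[k] B2)) (eps2 : B2 →ₗ[k] k)
    (actL : (B2 ⊗[k] B1) →ₗ[k] B1) (coactL : B1 →ₗ[k] (B2 ⊗[k] B1))
    (actR : (B2 ⊗[k] B1) →ₗ[k] B2) (coactR : B2 →ₗ[k] (B2 ⊗[k] B1)) : Prop :=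
    actL ∘ₗ ((merge2 m2) : (B2 ⊗[k] (B2 ⊗[k] B1)) →ₗ[k] (B2 ⊗[k] B1)) =
      actL ∘ₗ ((skp actL) : (B2 ⊗[k] (B2 ⊗[k] B1)) →ₗ[k] (B2 ⊗[k] B1))

noncomputable def ax_actL_unit (m1 : (B1 ⊗[k] B1) →ₗ[k] B1) (eta1 : k →ₗ[k] B1)
    (delta1 : B1 →ₗ[k] (B1 ⊗[k] B1)) (eps1 : B1 →ₗ[k] k)
    (m2 : (B2 ⊗[k] B2) →ₗ[k] B2) (eta2 : k →ₗ[k] B2)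
    (delta2 : B2 →ₗ[k] (B2 ⊗[k] B2)) (eps2 : B2 →ₗ[k] k)
    (actL : (B2 ⊗[k] B1) →ₗ[k] B1) (coactL : B1 →ₗ[k] (B2 ⊗[k] B1))
    (actR : (B2 ⊗[k] B1) →ₗ[k] B2) (coactR : B2 →ₗ[k] (B2 ⊗[k] B1)) : Prop :=
    actL ∘ₗ TensorProduct.map eta2 LinearMap.id ∘ₗ (TensorProduct.lid k B1).symm.toLinearMap =
      LinearMap.id

noncomputable def ax_actR_act (m1 : (B1 ⊗[k] B1) →ₗ[k] B1) (eta1 : k →ₗ[k] B1)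
    (delta1 : B1 →ₗ[k] (B1 ⊗[k] B1)) (eps1 : B1 →ₗ[k] k)
    (m2 : (B2 ⊗[k] B2) →ₗ[k] B2) (eta2 : k →ₗ[k] B2)
    (delta2 : B2 →ₗ[k] (B2 ⊗[k] B2)) (eps2 : B2 →ₗ[k] k)
    (actL : (B2 ⊗[k] B1) →ₗ[k] B1) (coactL : B1 →ₗ[k] (B2 ⊗[k] B1))
    (actR : (B2 ⊗[k] B1) →ₗ[k] B2) (coactR : B2 →ₗ[k] (B2 ⊗[k] B1)) : Prop :=
    actR ∘ₗ ((skp m1) : (B2 ⊗[k] (B1 ⊗[k] B1)) →ₗ[k] (B2 ⊗[k] B1)) =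
      actR ∘ₗ ((merge2 actR) : (B2 ⊗[k] (B1 ⊗[k] B1)) →ₗ[k] (B2 ⊗[k] B1))

noncomputable def ax_actR_unit (m1 : (B1 ⊗[k] B1) →ₗ[k] B1) (eta1 : k →ₗ[k] B1)
    (delta1 : B1 →ₗ[k] (B1 ⊗[k] B1)) (eps1 : B1 →ₗ[k] k)
    (m2 : (B2 ⊗[k] B2) →ₗ[k] B2) (eta2 : k →ₗ[k] B2)
    (delta2 : B2 →ₗ[k] (B2 ⊗[k] B2)) (eps2 : B2 →ₗ[k] k)
    (actL : (B2 ⊗[k] B1) →ₗ[k] B1) (coactL : B1 →ₗ[k] (B2 ⊗[k] B1))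
    (actR : (B2 ⊗[k] B1) →ₗ[k] B2) (coactR : B2 →ₗ[k] (B2 ⊗[k] B1)) : Prop :=
    actR ∘ₗ TensorProduct.map LinearMap.id eta1 ∘ₗ (TensorProduct.rid k B2).symm.toLinearMap =
      LinearMap.id

noncomputable def ax_coactL_coact (m1 : (B1 ⊗[k] B1) →ₗ[k] B1) (eta1 : k →ₗ[k] B1)
    (delta1 : B1 →ₗ[k] (B1 ⊗[k] B1)) (eps1 : B1 →ₗ[k] k)
    (m2 : (B2 ⊗[k] B2) →ₗ[k] B2) (eta2 : k →ₗ[k] B2)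
    (delta2 : B2 →ₗ[k] (B2 ⊗[k] B2)) (eps2 : B2 →ₗ[k] k)
    (actL : (B2 ⊗[k] B1) →ₗ[k] B1) (coactL : B1 →ₗ[k] (B2 ⊗[k] B1))
    (actR : (B2 ⊗[k] B1) →ₗ[k] B2) (coactR : B2 →ₗ[k] (B2 ⊗[k] B1)) : Prop :=
    ((split2 delta2) : (B2 ⊗[k] B1) →ₗ[k] (B2 ⊗[k] (B2 ⊗[k] B1))) ∘ₗ coactL =
      ((skp coactL) : (B2 ⊗[k] B1) →ₗ[k] (B2 ⊗[k] (B2 ⊗[k] B1))) ∘ₗ coactL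

noncomputable def ax_coactL_counit (m1 : (B1 ⊗[k] B1) →ₗ[k] B1) (eta1 : k →ₗ[k] B1)
    (delta1 : B1 →ₗ[k] (B1 ⊗[k] B1)) (eps1 : B1 →ₗ[k] k)
    (m2 : (B2 ⊗[k] B2) →ₗ[k] B2) (eta2 : k →ₗ[k] B2)
    (delta2 : B2 →ₗ[k] (B2 ⊗[k] B2)) (eps2 : B2 →ₗ[k] k)
    (actL : (B2 ⊗[k] B1) →ₗ[k] B1) (coactL : B1 →ₗ[k] (B2 ⊗[k] B1))
    (actR : (B2 ⊗[k] B1) →ₗ[k] B2) (coactR : B2 →ₗ[k] (B2 ⊗[k] B1)) : Prop :=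
    (TensorProduct.lid k B1).toLinearMap ∘ₗ TensorProduct.map eps2 LinearMap.id ∘ₗ coactL =
      LinearMap.id

noncomputable def ax_coactR_coact (m1 : (B1 ⊗[k] B1) →ₗ[k] B1) (eta1 : k →ₗ[k] B1)
    (delta1 : B1 →ₗ[k] (B1 ⊗[k] B1)) (eps1 : B1 →ₗ[k] k)
    (m2 : (B2 ⊗[k] B2) →ₗ[k] B2) (eta2 : k →ₗ[k] B2)
    (delta2 : B2 →ₗ[k] (B2 ⊗[k] B2)) (eps2 : B2 →ₗ[k] k)
    (actL : (B2 ⊗[k] B1) →ₗ[k] B1) (coactL : B1 →ₗ[k] (B2 ⊗[k] B1))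
    (actR : (B2 ⊗[k] B1) →ₗ[k] B2) (coactR : B2 →ₗ[k] (B2 ⊗[k] B1)) : Prop :=
    ((split2 coactR) : (B2 ⊗[k] B1) →ₗ[k] (B2 ⊗[k] (B1 ⊗[k] B1))) ∘ₗ coactR =
      ((skp delta1) : (B2 ⊗[k] B1) →ₗ[k] (B2 ⊗[k] (B1 ⊗[k] B1))) ∘ₗ coactR

noncomputable def ax_coactR_counit (m1 : (B1 ⊗[k] B1) →ₗ[k] B1) (eta1 : k →ₗ[k] B1)
    (delta1 : B1 →ₗ[k] (B1 ⊗[k] B1)) (eps1 : B1 →ₗ[k] k)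
    (m2 : (B2 ⊗[k] B2) →ₗ[k] B2) (eta2 : k →ₗ[k] B2)
    (delta2 : B2 →ₗ[k] (B2 ⊗[k] B2)) (eps2 : B2 →ₗ[k] k)
    (actL : (B2 ⊗[k] B1) →ₗ[k] B1) (coactL : B1 →ₗ[k] (B2 ⊗[k] B1))
    (actR : (B2 ⊗[k] B1) →ₗ[k] B2) (coactR : B2 →ₗ[k] (B2 ⊗[k] B1)) : Prop :=
    (TensorProduct.rid k B2).toLinearMap ∘ₗ TensorProduct.map LinearMap.id eps1 ∘ₗ coactR =
      LinearMap.id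

noncomputable def ax_actR_eta2 (m1 : (B1 ⊗[k] B1) →ₗ[k] B1) (eta1 : k →ₗ[k] B1)
    (delta1 : B1 →ₗ[k] (B1 ⊗[k] B1)) (eps1 : B1 →ₗ[k] k)
    (m2 : (B2 ⊗[k] B2) →ₗ[k] B2) (eta2 : k →ₗ[k] B2)
    (delta2 : B2 →ₗ[k] (B2 ⊗[k] B2)) (eps2 : B2 →ₗ[k] k)
    (actL : (B2 ⊗[k] B1) →ₗ[k] B1) (coactL : B1 →ₗ[k] (B2 ⊗[k] B1))
    (actR : (B2 ⊗[k] B1) →ₗ[k] B2) (coactR : B2 →ₗ[k] (B2 ⊗[k] B1)) : Prop :=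
    actR ∘ₗ TensorProduct.map eta2 LinearMap.id ∘ₗ (TensorProduct.lid k B1).symm.toLinearMap =
      eta2 ∘ₗ eps1

noncomputable def ax_coactL_eps1 (m1 : (B1 ⊗[k] B1) →ₗ[k] B1) (eta1 : k →ₗ[k] B1)
    (delta1 : B1 →ₗ[k] (B1 ⊗[k] B1)) (eps1 : B1 →ₗ[k] k)
    (m2 : (B2 ⊗[k] B2) →ₗ[k] B2) (eta2 : k →ₗ[k] B2)
    (delta2 : B2 →ₗ[k] (B2 ⊗[k] B2)) (eps2 : B2 →ₗ[k] k)
    (actL : (B2 ⊗[k] B1) →ₗ[k] B1) (coactL : B1 →ₗ[k] (B2 ⊗[k] B1))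
    (actR : (B2 ⊗[k] B1) →ₗ[k] B2) (coactR : B2 →ₗ[k] (B2 ⊗[k] B1)) : Prop :=
    (TensorProduct.rid k B2).toLinearMap ∘ₗ TensorProduct.map LinearMap.id eps1 ∘ₗ coactL =
      eta2 ∘ₗ eps1

noncomputable def ax_eps2_actR (m1 : (B1 ⊗[k] B1) →ₗ[k] B1) (eta1 : k →ₗ[k] B1)
    (delta1 : B1 →ₗ[k] (B1 ⊗[k] B1)) (eps1 : B1 →ₗ[k] k)
    (m2 : (B2 ⊗[k] B2) →ₗ[k] B2) (eta2 : k →ₗ[k] B2)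
    (delta2 : B2 →ₗ[k] (B2 ⊗[k] B2)) (eps2 : B2 →ₗ[k] k)
    (actL : (B2 ⊗[k] B1) →ₗ[k] B1) (coactL : B1 →ₗ[k] (B2 ⊗[k] B1))
    (actR : (B2 ⊗[k] B1) →ₗ[k] B2) (coactR : B2 →ₗ[k] (B2 ⊗[k] B1)) : Prop :=
    eps2 ∘ₗ actR = LinearMap.mul' k k ∘ₗ TensorProduct.map eps2 eps1

noncomputable def ax_eps1_actL (m1 : (B1 ⊗[k] B1) →ₗ[k] B1) (eta1 : k →ₗ[k] B1)
    (delta1 : B1 →ₗ[k] (B1 ⊗[k] B1)) (eps1 : B1 →ₗ[k] k)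
    (m2 : (B2 ⊗[k] B2) →ₗ[k] B2) (eta2 : k →ₗ[k] B2)
    (delta2 : B2 →ₗ[k] (B2 ⊗[k] B2)) (eps2 : B2 →ₗ[k] k)
    (actL : (B2 ⊗[k] B1) →ₗ[k] B1) (coactL : B1 →ₗ[k] (B2 ⊗[k] B1))
    (actR : (B2 ⊗[k] B1) →ₗ[k] B2) (coactR : B2 →ₗ[k] (B2 ⊗[k] B1)) : Prop :=
    eps1 ∘ₗ actL = LinearMap.mul' k k ∘ₗ TensorProduct.map eps2 eps1

noncomputable def ax_actL_eta1 (m1 : (B1 ⊗[k] B1) →ₗ[k] B1) (eta1 : k →ₗ[k] B1)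
    (delta1 : B1 →ₗ[k] (B1 ⊗[k] B1)) (eps1 : B1 →ₗ[k] k)
    (m2 : (B2 ⊗[k] B2) →ₗ[k] B2) (eta2 : k →ₗ[k] B2)
    (delta2 : B2 →ₗ[k] (B2 ⊗[k] B2)) (eps2 : B2 →ₗ[k] k)
    (actL : (B2 ⊗[k] B1) →ₗ[k] B1) (coactL : B1 →ₗ[k] (B2 ⊗[k] B1))
    (actR : (B2 ⊗[k] B1) →ₗ[k] B2) (coactR : B2 →ₗ[k] (B2 ⊗[k] B1)) : Prop :=
    actL ∘ₗ TensorProduct.map LinearMap.id eta1 ∘ₗ (TensorProduct.rid k B2).symm.toLinearMap =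
      eta1 ∘ₗ eps2

noncomputable def ax_coactR_eps2 (m1 : (B1 ⊗[k] B1) →ₗ[k] B1) (eta1 : k →ₗ[k] B1)
    (delta1 : B1 →ₗ[k] (B1 ⊗[k] B1)) (eps1 : B1 →ₗ[k] k)
    (m2 : (B2 ⊗[k] B2) →ₗ[k] B2) (eta2 : k →ₗ[k] B2)
    (delta2 : B2 →ₗ[k] (B2 ⊗[k] B2)) (eps2 : B2 →ₗ[k] k)
    (actL : (B2 ⊗[k] B1) →ₗ[k] B1) (coactL : B1 →ₗ[k] (B2 ⊗[k] B1))
    (actR : (B2 ⊗[k] B1) →ₗ[k] B2) (coactR : B2 →ₗ[k] (B2 ⊗[k] B1)) : Prop :=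
    (TensorProduct.lid k B1).toLinearMap ∘ₗ TensorProduct.map eps2 LinearMap.id ∘ₗ coactR =
      eta1 ∘ₗ eps2

noncomputable def ax_coactR_eta2 (m1 : (B1 ⊗[k] B1) →ₗ[k] B1) (eta1 : k →ₗ[k] B1)
    (delta1 : B1 →ₗ[k] (B1 ⊗[k] B1)) (eps1 : B1 →ₗ[k] k)
    (m2 : (B2 ⊗[k] B2) →ₗ[k] B2) (eta2 : k →ₗ[k] B2)
    (delta2 : B2 →ₗ[k] (B2 ⊗[k] B2)) (eps2 : B2 →ₗ[k] k)
    (actL : (B2 ⊗[k] B1) →ₗ[k] B1) (coactL : B1 →ₗ[k] (B2 ⊗[k] B1))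
    (actR : (B2 ⊗[k] B1) →ₗ[k] B2) (coactR : B2 →ₗ[k] (B2 ⊗[k] B1)) : Prop :=
    coactR ∘ₗ eta2 = TensorProduct.map eta2 eta1 ∘ₗ (TensorProduct.lid k k).symm.toLinearMap

noncomputable def ax_coactL_eta1 (m1 : (B1 ⊗[k] B1) →ₗ[k] B1) (eta1 : k →ₗ[k] B1)
    (delta1 : B1 →ₗ[k] (B1 ⊗[k] B1)) (eps1 : B1 →ₗ[k] k)
    (m2 : (B2 ⊗[k] B2) →ₗ[k] B2) (eta2 : k →ₗ[k] B2)
    (delta2 : B2 →ₗ[k] (B2 ⊗[k] B2)) (eps2 : B2 →ₗ[k] k)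
    (actL : (B2 ⊗[k] B1) →ₗ[k] B1) (coactL : B1 →ₗ[k] (B2 ⊗[k] B1))
    (actR : (B2 ⊗[k] B1) →ₗ[k] B2) (coactR : B2 →ₗ[k] (B2 ⊗[k] B1)) : Prop :=
    coactL ∘ₗ eta1 = TensorProduct.map eta2 eta1 ∘ₗ (TensorProduct.lid k k).symm.toLinearMap

noncomputable def ax_algCoalg1 (m1 : (B1 ⊗[k] B1) →ₗ[k] B1) (eta1 : k →ₗ[k] B1)
    (delta1 : B1 →ₗ[k] (B1 ⊗[k] B1)) (eps1 : B1 →ₗ[k] k)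
    (m2 : (B2 ⊗[k] B2) →ₗ[k] B2) (eta2 : k →ₗ[k] B2)
    (delta2 : B2 →ₗ[k] (B2 ⊗[k] B2)) (eps2 : B2 →ₗ[k] k)
    (actL : (B2 ⊗[k] B1) →ₗ[k] B1) (coactL : B1 →ₗ[k] (B2 ⊗[k] B1))
    (actR : (B2 ⊗[k] B1) →ₗ[k] B2) (coactR : B2 →ₗ[k] (B2 ⊗[k] B1)) : Prop :=
    (delta1 : B1 →ₗ[k] (B1 ⊗[k] B1))
      ∘ₗ (m1 : (B1 ⊗[k] B1) →ₗ[k] B1)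
    =
    ((skp m1) : (B1 ⊗[k] (B1 ⊗[k] B1)) →ₗ[k] (B1 ⊗[k] B1))
      ∘ₗ ((merge2 m1) : (B1 ⊗[k] (B1 ⊗[k] (B1 ⊗[k] B1))) →ₗ[k] (B1 ⊗[k] (B1 ⊗[k] B1)))
      ∘ₗ ((skp (merge2 actL)) : (B1 ⊗[k] (B2 ⊗[k] (B1 ⊗[k] (B1 ⊗[k] B1)))) →ₗ[k] (B1 ⊗[k] (B1 ⊗[k] (B1 ⊗[k] B1))))
      ∘ₗ ((skp (skp swap2)) : (B1 ⊗[k] (B2 ⊗[k] (B1 ⊗[k] (B1 ⊗[k] B1)))) →ₗ[k] (B1 ⊗[k] (B2 ⊗[k] (B1 ⊗[k] (B1 ⊗[k] B1)))))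
      ∘ₗ ((skp (split2 coactL)) : (B1 ⊗[k] (B1 ⊗[k] (B1 ⊗[k] B1))) →ₗ[k] (B1 ⊗[k] (B2 ⊗[k] (B1 ⊗[k] (B1 ⊗[k] B1)))))
      ∘ₗ ((skp (skp delta1)) : (B1 ⊗[k] (B1 ⊗[k] B1)) →ₗ[k] (B1 ⊗[k] (B1 ⊗[k] (B1 ⊗[k] B1))))
      ∘ₗ ((split2 delta1) : (B1 ⊗[k] B1) →ₗ[k] (B1 ⊗[k] (B1 ⊗[k] B1)))

noncomputable def ax_algCoalg2 (m1 : (B1 ⊗[k] B1) →ₗ[k] B1) (eta1 : k →ₗ[k] B1)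
    (delta1 : B1 →ₗ[k] (B1 ⊗[k] B1)) (eps1 : B1 →ₗ[k] k)
    (m2 : (B2 ⊗[k] B2) →ₗ[k] B2) (eta2 : k →ₗ[k] B2)
    (delta2 : B2 →ₗ[k] (B2 ⊗[k] B2)) (eps2 : B2 →ₗ[k] k)
    (actL : (B2 ⊗[k] B1) →ₗ[k] B1) (coactL : B1 →ₗ[k] (B2 ⊗[k] B1))
    (actR : (B2 ⊗[k] B1) →ₗ[k] B2) (coactR : B2 →ₗ[k] (B2 ⊗[k] B1)) : Prop :=
    (delta2 : B2 →ₗ[k] (B2 ⊗[k] B2))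
      ∘ₗ (m2 : (B2 ⊗[k] B2) →ₗ[k] B2)
    =
    ((skp m2) : (B2 ⊗[k] (B2 ⊗[k] B2)) →ₗ[k] (B2 ⊗[k] B2))
      ∘ₗ ((merge2 m2) : (B2 ⊗[k] (B2 ⊗[k] (B2 ⊗[k] B2))) →ₗ[k] (B2 ⊗[k] (B2 ⊗[k] B2)))
      ∘ₗ ((skp (skp (merge2 actR))) : (B2 ⊗[k] (B2 ⊗[k] (B2 ⊗[k] (B1 ⊗[k] B2)))) →ₗ[k] (B2 ⊗[k] (B2 ⊗[k] (B2 ⊗[k] B2))))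
      ∘ₗ ((skp swap2) : (B2 ⊗[k] (B2 ⊗[k] (B2 ⊗[k] (B1 ⊗[k] B2)))) →ₗ[k] (B2 ⊗[k] (B2 ⊗[k] (B2 ⊗[k] (B1 ⊗[k] B2)))))
      ∘ₗ ((skp (skp (split2 coactR))) : (B2 ⊗[k] (B2 ⊗[k] (B2 ⊗[k] B2))) →ₗ[k] (B2 ⊗[k] (B2 ⊗[k] (B2 ⊗[k] (B1 ⊗[k] B2)))))
      ∘ₗ ((skp (skp delta2)) : (B2 ⊗[k] (B2 ⊗[k] B2)) →ₗ[k] (B2 ⊗[k] (B2 ⊗[k] (B2 ⊗[k] B2))))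
      ∘ₗ ((split2 delta2) : (B2 ⊗[k] B2) →ₗ[k] (B2 ⊗[k] (B2 ⊗[k] B2)))

noncomputable def ax_modComod (m1 : (B1 ⊗[k] B1) →ₗ[k] B1) (eta1 : k →ₗ[k] B1)
    (delta1 : B1 →ₗ[k] (B1 ⊗[k] B1)) (eps1 : B1 →ₗ[k] k)
    (m2 : (B2 ⊗[k] B2) →ₗ[k] B2) (eta2 : k →ₗ[k] B2)
    (delta2 : B2 →ₗ[k] (B2 ⊗[k] B2)) (eps2 : B2 →ₗ[k] k)
    (actL : (B2 ⊗[k] B1) →ₗ[k] B1) (coactL : B1 →ₗ[k] (B2 ⊗[k] B1))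
    (actR : (B2 ⊗[k] B1) →ₗ[k] B2) (coactR : B2 →ₗ[k] (B2 ⊗[k] B1)) : Prop :=
    ((skp m1) : (B2 ⊗[k] (B1 ⊗[k] B1)) →ₗ[k] (B2 ⊗[k] B1))
      ∘ₗ ((merge2 m2) : (B2 ⊗[k] (B2 ⊗[k] (B1 ⊗[k] B1))) →ₗ[k] (B2 ⊗[k] (B1 ⊗[k] B1)))
      ∘ₗ ((skp swap2) : (B2 ⊗[k] (B1 ⊗[k] (B2 ⊗[k] B1))) →ₗ[k] (B2 ⊗[k] (B2 ⊗[k] (B1 ⊗[k] B1))))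
      ∘ₗ ((skp (skp coactR)) : (B2 ⊗[k] (B1 ⊗[k] B2)) →ₗ[k] (B2 ⊗[k] (B1 ⊗[k] (B2 ⊗[k] B1))))
      ∘ₗ ((split2 coactL) : (B1 ⊗[k] B2) →ₗ[k] (B2 ⊗[k] (B1 ⊗[k] B2)))
      ∘ₗ ((skp actR) : (B1 ⊗[k] (B2 ⊗[k] B1)) →ₗ[k] (B1 ⊗[k] B2))
      ∘ₗ ((merge2 actL) : (B2 ⊗[k] (B1 ⊗[k] (B2 ⊗[k] B1))) →ₗ[k] (B1 ⊗[k] (B2 ⊗[k] B1)))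
      ∘ₗ ((skp swap2) : (B2 ⊗[k] (B2 ⊗[k] (B1 ⊗[k] B1))) →ₗ[k] (B2 ⊗[k] (B1 ⊗[k] (B2 ⊗[k] B1))))
      ∘ₗ ((skp (skp delta1)) : (B2 ⊗[k] (B2 ⊗[k] B1)) →ₗ[k] (B2 ⊗[k] (B2 ⊗[k] (B1 ⊗[k] B1))))
      ∘ₗ ((split2 delta2) : (B2 ⊗[k] B1) →ₗ[k] (B2 ⊗[k] (B2 ⊗[k] B1)))
    =
    ((skp m1) : (B2 ⊗[k] (B1 ⊗[k] B1)) →ₗ[k] (B2 ⊗[k] B1))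
      ∘ₗ ((merge2 m2) : (B2 ⊗[k] (B2 ⊗[k] (B1 ⊗[k] B1))) →ₗ[k] (B2 ⊗[k] (B1 ⊗[k] B1)))
      ∘ₗ ((skp (skp (skp actL))) : (B2 ⊗[k] (B2 ⊗[k] (B1 ⊗[k] (B2 ⊗[k] B1)))) →ₗ[k] (B2 ⊗[k] (B2 ⊗[k] (B1 ⊗[k] B1))))
      ∘ₗ ((skp swap2) : (B2 ⊗[k] (B1 ⊗[k] (B2 ⊗[k] (B2 ⊗[k] B1)))) →ₗ[k] (B2 ⊗[k] (B2 ⊗[k] (B1 ⊗[k] (B2 ⊗[k] B1)))))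
      ∘ₗ ((merge2 actR) : (B2 ⊗[k] (B1 ⊗[k] (B1 ⊗[k] (B2 ⊗[k] (B2 ⊗[k] B1))))) →ₗ[k] (B2 ⊗[k] (B1 ⊗[k] (B2 ⊗[k] (B2 ⊗[k] B1)))))
      ∘ₗ ((skp (skp (skp swap2))) : (B2 ⊗[k] (B1 ⊗[k] (B1 ⊗[k] (B2 ⊗[k] (B2 ⊗[k] B1))))) →ₗ[k] (B2 ⊗[k] (B1 ⊗[k] (B1 ⊗[k] (B2 ⊗[k] (B2 ⊗[k] B1))))))
      ∘ₗ ((skp swap2) : (B2 ⊗[k] (B1 ⊗[k] (B1 ⊗[k] (B2 ⊗[k] (B2 ⊗[k] B1))))) →ₗ[k] (B2 ⊗[k] (B1 ⊗[k] (B1 ⊗[k] (B2 ⊗[k] (B2 ⊗[k] B1))))))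
      ∘ₗ ((skp (skp (skp (skp coactL)))) : (B2 ⊗[k] (B1 ⊗[k] (B1 ⊗[k] (B2 ⊗[k] B1)))) →ₗ[k] (B2 ⊗[k] (B1 ⊗[k] (B1 ⊗[k] (B2 ⊗[k] (B2 ⊗[k] B1))))))
      ∘ₗ ((skp (skp swap2)) : (B2 ⊗[k] (B1 ⊗[k] (B2 ⊗[k] (B1 ⊗[k] B1)))) →ₗ[k] (B2 ⊗[k] (B1 ⊗[k] (B1 ⊗[k] (B2 ⊗[k] B1)))))
      ∘ₗ ((split2 coactR) : (B2 ⊗[k] (B2 ⊗[k] (B1 ⊗[k] B1))) →ₗ[k] (B2 ⊗[k] (B1 ⊗[k] (B2 ⊗[k] (B1 ⊗[k] B1)))))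
      ∘ₗ ((skp (skp delta1)) : (B2 ⊗[k] (B2 ⊗[k] B1)) →ₗ[k] (B2 ⊗[k] (B2 ⊗[k] (B1 ⊗[k] B1))))
      ∘ₗ ((split2 delta2) : (B2 ⊗[k] B1) →ₗ[k] (B2 ⊗[k] (B2 ⊗[k] B1)))

noncomputable def ax_modAlg1 (m1 : (B1 ⊗[k] B1) →ₗ[k] B1) (eta1 : k →ₗ[k] B1)
    (delta1 : B1 →ₗ[k] (B1 ⊗[k] B1)) (eps1 : B1 →ₗ[k] k)
    (m2 : (B2 ⊗[k] B2) →ₗ[k] B2) (eta2 : k →ₗ[k] B2)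
    (delta2 : B2 →ₗ[k] (B2 ⊗[k] B2)) (eps2 : B2 →ₗ[k] k)
    (actL : (B2 ⊗[k] B1) →ₗ[k] B1) (coactL : B1 →ₗ[k] (B2 ⊗[k] B1))
    (actR : (B2 ⊗[k] B1) →ₗ[k] B2) (coactR : B2 →ₗ[k] (B2 ⊗[k] B1)) : Prop :=
    (actR : (B2 ⊗[k] B1) →ₗ[k] B2)
      ∘ₗ ((merge2 m2) : (B2 ⊗[k] (B2 ⊗[k] B1)) →ₗ[k] (B2 ⊗[k] B1))
    =
    (m2 : (B2 ⊗[k] B2) →ₗ[k] B2)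
      ∘ₗ ((merge2 actR) : (B2 ⊗[k] (B1 ⊗[k] B2)) →ₗ[k] (B2 ⊗[k] B2))
      ∘ₗ ((skp (skp actR)) : (B2 ⊗[k] (B1 ⊗[k] (B2 ⊗[k] B1))) →ₗ[k] (B2 ⊗[k] (B1 ⊗[k] B2)))
      ∘ₗ ((skp (merge2 actL)) : (B2 ⊗[k] (B2 ⊗[k] (B1 ⊗[k] (B2 ⊗[k] B1)))) →ₗ[k] (B2 ⊗[k] (B1 ⊗[k] (B2 ⊗[k] B1))))
      ∘ₗ ((skp (skp swap2)) : (B2 ⊗[k] (B2 ⊗[k] (B2 ⊗[k] (B1 ⊗[k] B1)))) →ₗ[k] (B2 ⊗[k] (B2 ⊗[k] (B1 ⊗[k] (B2 ⊗[k] B1)))))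
      ∘ₗ ((skp (skp (skp delta1))) : (B2 ⊗[k] (B2 ⊗[k] (B2 ⊗[k] B1))) →ₗ[k] (B2 ⊗[k] (B2 ⊗[k] (B2 ⊗[k] (B1 ⊗[k] B1)))))
      ∘ₗ ((skp (split2 delta2)) : (B2 ⊗[k] (B2 ⊗[k] B1)) →ₗ[k] (B2 ⊗[k] (B2 ⊗[k] (B2 ⊗[k] B1))))

noncomputable def ax_modAlg2 (m1 : (B1 ⊗[k] B1) →ₗ[k] B1) (eta1 : k →ₗ[k] B1)
    (delta1 : B1 →ₗ[k] (B1 ⊗[k] B1)) (eps1 : B1 →ₗ[k] k)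
    (m2 : (B2 ⊗[k] B2) →ₗ[k] B2) (eta2 : k →ₗ[k] B2)
    (delta2 : B2 →ₗ[k] (B2 ⊗[k] B2)) (eps2 : B2 →ₗ[k] k)
    (actL : (B2 ⊗[k] B1) →ₗ[k] B1) (coactL : B1 →ₗ[k] (B2 ⊗[k] B1))
    (actR : (B2 ⊗[k] B1) →ₗ[k] B2) (coactR : B2 →ₗ[k] (B2 ⊗[k] B1)) : Prop :=
    (actL : (B2 ⊗[k] B1) →ₗ[k] B1)
      ∘ₗ ((skp m1) : (B2 ⊗[k] (B1 ⊗[k] B1)) →ₗ[k] (B2 ⊗[k] B1))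
    =
    (m1 : (B1 ⊗[k] B1) →ₗ[k] B1)
      ∘ₗ ((skp actL) : (B1 ⊗[k] (B2 ⊗[k] B1)) →ₗ[k] (B1 ⊗[k] B1))
      ∘ₗ ((skp (merge2 actR)) : (B1 ⊗[k] (B2 ⊗[k] (B1 ⊗[k] B1))) →ₗ[k] (B1 ⊗[k] (B2 ⊗[k] B1)))
      ∘ₗ ((merge2 actL) : (B2 ⊗[k] (B1 ⊗[k] (B2 ⊗[k] (B1 ⊗[k] B1)))) →ₗ[k] (B1 ⊗[k] (B2 ⊗[k] (B1 ⊗[k] B1))))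
      ∘ₗ ((skp swap2) : (B2 ⊗[k] (B2 ⊗[k] (B1 ⊗[k] (B1 ⊗[k] B1)))) →ₗ[k] (B2 ⊗[k] (B1 ⊗[k] (B2 ⊗[k] (B1 ⊗[k] B1)))))
      ∘ₗ ((skp (skp (split2 delta1))) : (B2 ⊗[k] (B2 ⊗[k] (B1 ⊗[k] B1))) →ₗ[k] (B2 ⊗[k] (B2 ⊗[k] (B1 ⊗[k] (B1 ⊗[k] B1)))))
      ∘ₗ ((split2 delta2) : (B2 ⊗[k] (B1 ⊗[k] B1)) →ₗ[k] (B2 ⊗[k] (B2 ⊗[k] (B1 ⊗[k] B1))))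

noncomputable def ax_comodCoalg1 (m1 : (B1 ⊗[k] B1) →ₗ[k] B1) (eta1 : k →ₗ[k] B1)
    (delta1 : B1 →ₗ[k] (B1 ⊗[k] B1)) (eps1 : B1 →ₗ[k] k)
    (m2 : (B2 ⊗[k] B2) →ₗ[k] B2) (eta2 : k →ₗ[k] B2)
    (delta2 : B2 →ₗ[k] (B2 ⊗[k] B2)) (eps2 : B2 →ₗ[k] k)
    (actL : (B2 ⊗[k] B1) →ₗ[k] B1) (coactL : B1 →ₗ[k] (B2 ⊗[k] B1))
    (actR : (B2 ⊗[k] B1) →ₗ[k] B2) (coactR : B2 →ₗ[k] (B2 ⊗[k] B1)) : Prop :=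
    ((split2 delta2) : (B2 ⊗[k] B1) →ₗ[k] (B2 ⊗[k] (B2 ⊗[k] B1)))
      ∘ₗ (coactR : B2 →ₗ[k] (B2 ⊗[k] B1))
    =
    ((skp (skp m1)) : (B2 ⊗[k] (B2 ⊗[k] (B1 ⊗[k] B1))) →ₗ[k] (B2 ⊗[k] (B2 ⊗[k] B1)))
      ∘ₗ ((skp (merge2 m2)) : (B2 ⊗[k] (B2 ⊗[k] (B2 ⊗[k] (B1 ⊗[k] B1)))) →ₗ[k] (B2 ⊗[k] (B2 ⊗[k] (B1 ⊗[k] B1))))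
      ∘ₗ ((skp (skp swap2)) : (B2 ⊗[k] (B2 ⊗[k] (B1 ⊗[k] (B2 ⊗[k] B1)))) →ₗ[k] (B2 ⊗[k] (B2 ⊗[k] (B2 ⊗[k] (B1 ⊗[k] B1)))))
      ∘ₗ ((skp (skp (skp coactR))) : (B2 ⊗[k] (B2 ⊗[k] (B1 ⊗[k] B2))) →ₗ[k] (B2 ⊗[k] (B2 ⊗[k] (B1 ⊗[k] (B2 ⊗[k] B1)))))
      ∘ₗ ((skp (split2 coactL)) : (B2 ⊗[k] (B1 ⊗[k] B2)) →ₗ[k] (B2 ⊗[k] (B2 ⊗[k] (B1 ⊗[k] B2))))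
      ∘ₗ ((split2 coactR) : (B2 ⊗[k] B2) →ₗ[k] (B2 ⊗[k] (B1 ⊗[k] B2)))
      ∘ₗ (delta2 : B2 →ₗ[k] (B2 ⊗[k] B2))

noncomputable def ax_comodCoalg2 (m1 : (B1 ⊗[k] B1) →ₗ[k] B1) (eta1 : k →ₗ[k] B1)
    (delta1 : B1 →ₗ[k] (B1 ⊗[k] B1)) (eps1 : B1 →ₗ[k] k)
    (m2 : (B2 ⊗[k] B2) →ₗ[k] B2) (eta2 : k →ₗ[k] B2)
    (delta2 : B2 →ₗ[k] (B2 ⊗[k] B2)) (eps2 : B2 →ₗ[k] k)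
    (actL : (B2 ⊗[k] B1) →ₗ[k] B1) (coactL : B1 →ₗ[k] (B2 ⊗[k] B1))
    (actR : (B2 ⊗[k] B1) →ₗ[k] B2) (coactR : B2 →ₗ[k] (B2 ⊗[k] B1)) : Prop :=
    ((skp delta1) : (B2 ⊗[k] B1) →ₗ[k] (B2 ⊗[k] (B1 ⊗[k] B1)))
      ∘ₗ (coactL : B1 →ₗ[k] (B2 ⊗[k] B1))
    =
    ((skp (merge2 m1)) : (B2 ⊗[k] (B1 ⊗[k] (B1 ⊗[k] B1))) →ₗ[k] (B2 ⊗[k] (B1 ⊗[k] B1)))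
      ∘ₗ ((merge2 m2) : (B2 ⊗[k] (B2 ⊗[k] (B1 ⊗[k] (B1 ⊗[k] B1)))) →ₗ[k] (B2 ⊗[k] (B1 ⊗[k] (B1 ⊗[k] B1))))
      ∘ₗ ((skp swap2) : (B2 ⊗[k] (B1 ⊗[k] (B2 ⊗[k] (B1 ⊗[k] B1)))) →ₗ[k] (B2 ⊗[k] (B2 ⊗[k] (B1 ⊗[k] (B1 ⊗[k] B1)))))
      ∘ₗ ((skp (skp (split2 coactR))) : (B2 ⊗[k] (B1 ⊗[k] (B2 ⊗[k] B1))) →ₗ[k] (B2 ⊗[k] (B1 ⊗[k] (B2 ⊗[k] (B1 ⊗[k] B1)))))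
      ∘ₗ ((skp (skp coactL)) : (B2 ⊗[k] (B1 ⊗[k] B1)) →ₗ[k] (B2 ⊗[k] (B1 ⊗[k] (B2 ⊗[k] B1))))
      ∘ₗ ((split2 coactL) : (B1 ⊗[k] B1) →ₗ[k] (B2 ⊗[k] (B1 ⊗[k] B1)))
      ∘ₗ (delta1 : B1 →ₗ[k] (B1 ⊗[k] B1))

noncomputable def ax_modCoalg1 (m1 : (B1 ⊗[k] B1) →ₗ[k] B1) (eta1 : k →ₗ[k] B1)
    (delta1 : B1 →ₗ[k] (B1 ⊗[k] B1)) (eps1 : B1 →ₗ[k] k)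
    (m2 : (B2 ⊗[k] B2) →ₗ[k] B2) (eta2 : k →ₗ[k] B2)
    (delta2 : B2 →ₗ[k] (B2 ⊗[k] B2)) (eps2 : B2 →ₗ[k] k)
    (actL : (B2 ⊗[k] B1) →ₗ[k] B1) (coactL : B1 →ₗ[k] (B2 ⊗[k] B1))
    (actR : (B2 ⊗[k] B1) →ₗ[k] B2) (coactR : B2 →ₗ[k] (B2 ⊗[k] B1)) : Prop :=
    (delta2 : B2 →ₗ[k] (B2 ⊗[k] B2))
      ∘ₗ (actR : (B2 ⊗[k] B1) →ₗ[k] B2)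
    =
    ((merge2 m2) : (B2 ⊗[k] (B2 ⊗[k] B2)) →ₗ[k] (B2 ⊗[k] B2))
      ∘ₗ ((skp (skp actR)) : (B2 ⊗[k] (B2 ⊗[k] (B2 ⊗[k] B1))) →ₗ[k] (B2 ⊗[k] (B2 ⊗[k] B2)))
      ∘ₗ ((skp swap2) : (B2 ⊗[k] (B2 ⊗[k] (B2 ⊗[k] B1))) →ₗ[k] (B2 ⊗[k] (B2 ⊗[k] (B2 ⊗[k] B1))))
      ∘ₗ ((merge2 actR) : (B2 ⊗[k] (B1 ⊗[k] (B2 ⊗[k] (B2 ⊗[k] B1)))) →ₗ[k] (B2 ⊗[k] (B2 ⊗[k] (B2 ⊗[k] B1))))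
      ∘ₗ ((skp (skp (skp coactL))) : (B2 ⊗[k] (B1 ⊗[k] (B2 ⊗[k] B1))) →ₗ[k] (B2 ⊗[k] (B1 ⊗[k] (B2 ⊗[k] (B2 ⊗[k] B1)))))
      ∘ₗ ((skp swap2) : (B2 ⊗[k] (B2 ⊗[k] (B1 ⊗[k] B1))) →ₗ[k] (B2 ⊗[k] (B1 ⊗[k] (B2 ⊗[k] B1))))
      ∘ₗ ((skp (skp delta1)) : (B2 ⊗[k] (B2 ⊗[k] B1)) →ₗ[k] (B2 ⊗[k] (B2 ⊗[k] (B1 ⊗[k] B1))))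
      ∘ₗ ((split2 delta2) : (B2 ⊗[k] B1) →ₗ[k] (B2 ⊗[k] (B2 ⊗[k] B1)))

noncomputable def ax_modCoalg2 (m1 : (B1 ⊗[k] B1) →ₗ[k] B1) (eta1 : k →ₗ[k] B1)
    (delta1 : B1 →ₗ[k] (B1 ⊗[k] B1)) (eps1 : B1 →ₗ[k] k)
    (m2 : (B2 ⊗[k] B2) →ₗ[k] B2) (eta2 : k →ₗ[k] B2)
    (delta2 : B2 →ₗ[k] (B2 ⊗[k] B2)) (eps2 : B2 →ₗ[k] k)
    (actL : (B2 ⊗[k] B1) →ₗ[k] B1) (coactL : B1 →ₗ[k] (B2 ⊗[k] B1))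
    (actR : (B2 ⊗[k] B1) →ₗ[k] B2) (coactR : B2 →ₗ[k] (B2 ⊗[k] B1)) : Prop :=
    (delta1 : B1 →ₗ[k] (B1 ⊗[k] B1))
      ∘ₗ (actL : (B2 ⊗[k] B1) →ₗ[k] B1)
    =
    ((skp m1) : (B1 ⊗[k] (B1 ⊗[k] B1)) →ₗ[k] (B1 ⊗[k] B1))
      ∘ₗ ((skp (skp actL)) : (B1 ⊗[k] (B1 ⊗[k] (B2 ⊗[k] B1))) →ₗ[k] (B1 ⊗[k] (B1 ⊗[k] B1)))
      ∘ₗ ((merge2 actL) : (B2 ⊗[k] (B1 ⊗[k] (B1 ⊗[k] (B2 ⊗[k] B1)))) →ₗ[k] (B1 ⊗[k] (B1 ⊗[k] (B2 ⊗[k] B1))))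
      ∘ₗ ((skp swap2) : (B2 ⊗[k] (B1 ⊗[k] (B1 ⊗[k] (B2 ⊗[k] B1)))) →ₗ[k] (B2 ⊗[k] (B1 ⊗[k] (B1 ⊗[k] (B2 ⊗[k] B1)))))
      ∘ₗ ((split2 coactR) : (B2 ⊗[k] (B1 ⊗[k] (B2 ⊗[k] B1))) →ₗ[k] (B2 ⊗[k] (B1 ⊗[k] (B1 ⊗[k] (B2 ⊗[k] B1)))))
      ∘ₗ ((skp swap2) : (B2 ⊗[k] (B2 ⊗[k] (B1 ⊗[k] B1))) →ₗ[k] (B2 ⊗[k] (B1 ⊗[k] (B2 ⊗[k] B1))))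
      ∘ₗ ((skp (skp delta1)) : (B2 ⊗[k] (B2 ⊗[k] B1)) →ₗ[k] (B2 ⊗[k] (B2 ⊗[k] (B1 ⊗[k] B1))))
      ∘ₗ ((split2 delta2) : (B2 ⊗[k] B1) →ₗ[k] (B2 ⊗[k] (B2 ⊗[k] B1)))

noncomputable def ax_comodAlg1 (m1 : (B1 ⊗[k] B1) →ₗ[k] B1) (eta1 : k →ₗ[k] B1)
    (delta1 : B1 →ₗ[k] (B1 ⊗[k] B1)) (eps1 : B1 →ₗ[k] k)
    (m2 : (B2 ⊗[k] B2) →ₗ[k] B2) (eta2 : k →ₗ[k] B2)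
    (delta2 : B2 →ₗ[k] (B2 ⊗[k] B2)) (eps2 : B2 →ₗ[k] k)
    (actL : (B2 ⊗[k] B1) →ₗ[k] B1) (coactL : B1 →ₗ[k] (B2 ⊗[k] B1))
    (actR : (B2 ⊗[k] B1) →ₗ[k] B2) (coactR : B2 →ₗ[k] (B2 ⊗[k] B1)) : Prop :=
    (coactR : B2 →ₗ[k] (B2 ⊗[k] B1))
      ∘ₗ (m2 : (B2 ⊗[k] B2) →ₗ[k] B2)
    =
    ((skp m1) : (B2 ⊗[k] (B1 ⊗[k] B1)) →ₗ[k] (B2 ⊗[k] B1))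
      ∘ₗ ((skp (skp actL)) : (B2 ⊗[k] (B1 ⊗[k] (B2 ⊗[k] B1))) →ₗ[k] (B2 ⊗[k] (B1 ⊗[k] B1)))
      ∘ₗ ((merge2 m2) : (B2 ⊗[k] (B2 ⊗[k] (B1 ⊗[k] (B2 ⊗[k] B1)))) →ₗ[k] (B2 ⊗[k] (B1 ⊗[k] (B2 ⊗[k] B1))))
      ∘ₗ ((skp swap2) : (B2 ⊗[k] (B1 ⊗[k] (B2 ⊗[k] (B2 ⊗[k] B1)))) →ₗ[k] (B2 ⊗[k] (B2 ⊗[k] (B1 ⊗[k] (B2 ⊗[k] B1)))))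
      ∘ₗ ((skp (skp swap2)) : (B2 ⊗[k] (B1 ⊗[k] (B2 ⊗[k] (B2 ⊗[k] B1)))) →ₗ[k] (B2 ⊗[k] (B1 ⊗[k] (B2 ⊗[k] (B2 ⊗[k] B1)))))
      ∘ₗ ((skp (skp (skp coactR))) : (B2 ⊗[k] (B1 ⊗[k] (B2 ⊗[k] B2))) →ₗ[k] (B2 ⊗[k] (B1 ⊗[k] (B2 ⊗[k] (B2 ⊗[k] B1)))))
      ∘ₗ ((split2 coactR) : (B2 ⊗[k] (B2 ⊗[k] B2)) →ₗ[k] (B2 ⊗[k] (B1 ⊗[k] (B2 ⊗[k] B2))))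
      ∘ₗ ((split2 delta2) : (B2 ⊗[k] B2) →ₗ[k] (B2 ⊗[k] (B2 ⊗[k] B2)))

noncomputable def ax_comodAlg2 (m1 : (B1 ⊗[k] B1) →ₗ[k] B1) (eta1 : k →ₗ[k] B1)
    (delta1 : B1 →ₗ[k] (B1 ⊗[k] B1)) (eps1 : B1 →ₗ[k] k)
    (m2 : (B2 ⊗[k] B2) →ₗ[k] B2) (eta2 : k →ₗ[k] B2)
    (delta2 : B2 →ₗ[k] (B2 ⊗[k] B2)) (eps2 : B2 →ₗ[k] k)
    (actL : (B2 ⊗[k] B1) →ₗ[k] B1) (coactL : B1 →ₗ[k] (B2 ⊗[k] B1))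
    (actR : (B2 ⊗[k] B1) →ₗ[k] B2) (coactR : B2 →ₗ[k] (B2 ⊗[k] B1)) : Prop :=
    (coactL : B1 →ₗ[k] (B2 ⊗[k] B1))
      ∘ₗ (m1 : (B1 ⊗[k] B1) →ₗ[k] B1)
    =
    ((skp m1) : (B2 ⊗[k] (B1 ⊗[k] B1)) →ₗ[k] (B2 ⊗[k] B1))
      ∘ₗ ((merge2 m2) : (B2 ⊗[k] (B2 ⊗[k] (B1 ⊗[k] B1))) →ₗ[k] (B2 ⊗[k] (B1 ⊗[k] B1)))
      ∘ₗ ((skp swap2) : (B2 ⊗[k] (B1 ⊗[k] (B2 ⊗[k] B1))) →ₗ[k] (B2 ⊗[k] (B2 ⊗[k] (B1 ⊗[k] B1))))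
      ∘ₗ ((skp (skp coactL)) : (B2 ⊗[k] (B1 ⊗[k] B1)) →ₗ[k] (B2 ⊗[k] (B1 ⊗[k] (B2 ⊗[k] B1))))
      ∘ₗ ((merge2 actR) : (B2 ⊗[k] (B1 ⊗[k] (B1 ⊗[k] B1))) →ₗ[k] (B2 ⊗[k] (B1 ⊗[k] B1)))
      ∘ₗ ((skp swap2) : (B2 ⊗[k] (B1 ⊗[k] (B1 ⊗[k] B1))) →ₗ[k] (B2 ⊗[k] (B1 ⊗[k] (B1 ⊗[k] B1))))
      ∘ₗ ((skp (skp delta1)) : (B2 ⊗[k] (B1 ⊗[k] B1)) →ₗ[k] (B2 ⊗[k] (B1 ⊗[k] (B1 ⊗[k] B1))))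
      ∘ₗ ((split2 coactL) : (B1 ⊗[k] B1) →ₗ[k] (B2 ⊗[k] (B1 ⊗[k] B1)))


/-- A Hopf datum in the sense of Definition 2.5 of Bespalov-Drabant,
"Cross Product Bialgebras I", in the symmetric monoidal category of `k`-modules:
two objects which are both (counital) algebras and (unital) coalgebras, `B1` a left
`B2`-module and -comodule, `B2` a right `B1`-module and -comodule, subject to the
algebra-coalgebra, module-comodule, module-algebra, comodule-coalgebra, module-coalgebra
and comodule-algebra compatibilities. -/
structure HopfDatum where
  m1 : (B1 ⊗[k] B1) →ₗ[k] B1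
  eta1 : k →ₗ[k] B1
  delta1 : B1 →ₗ[k] (B1 ⊗[k] B1)
  eps1 : B1 →ₗ[k] k
  m2 : (B2 ⊗[k] B2) →ₗ[k] B2
  eta2 : k →ₗ[k] B2
  delta2 : B2 →ₗ[k] (B2 ⊗[k] B2)
  eps2 : B2 →ₗ[k] k
  actL : (B2 ⊗[k] B1) →ₗ[k] B1
  coactL : B1 →ₗ[k] (B2 ⊗[k] B1)
  actR : (B2 ⊗[k] B1) →ₗ[k] B2
  coactR : B2 →ₗ[k] (B2 ⊗[k] B1)
  alg1 : IsAlgMaps k B1 m1 eta1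
  coalg1 : IsCoalgMaps k B1 delta1 eps1
  alg2 : IsAlgMaps k B2 m2 eta2
  coalg2 : IsCoalgMaps k B2 delta2 eps2
  epseta1 : eps1 ∘ₗ eta1 = LinearMap.id
  epseta2 : eps2 ∘ₗ eta2 = LinearMap.id
  actL_act : ax_actL_act k B1 B2 m1 eta1 delta1 eps1 m2 eta2 delta2 eps2 actL coactL actR coactR
  actL_unit : ax_actL_unit k B1 B2 m1 eta1 delta1 eps1 m2 eta2 delta2 eps2 actL coactL actR coactR
  actR_act : ax_actR_act k B1 B2 m1 eta1 delta1 eps1 m2 eta2 delta2 eps2 actL coactL actR coactR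
  actR_unit : ax_actR_unit k B1 B2 m1 eta1 delta1 eps1 m2 eta2 delta2 eps2 actL coactL actR coactR
  coactL_coact : ax_coactL_coact k B1 B2 m1 eta1 delta1 eps1 m2 eta2 delta2 eps2 actL coactL actR coactR
  coactL_counit : ax_coactL_counit k B1 B2 m1 eta1 delta1 eps1 m2 eta2 delta2 eps2 actL coactL actR coactR
  coactR_coact : ax_coactR_coact k B1 B2 m1 eta1 delta1 eps1 m2 eta2 delta2 eps2 actL coactL actR coactR
  coactR_counit : ax_coactR_counit k B1 B2 m1 eta1 delta1 eps1 m2 eta2 delta2 eps2 actL coactL actR coactR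
  actR_eta2 : ax_actR_eta2 k B1 B2 m1 eta1 delta1 eps1 m2 eta2 delta2 eps2 actL coactL actR coactR
  coactL_eps1 : ax_coactL_eps1 k B1 B2 m1 eta1 delta1 eps1 m2 eta2 delta2 eps2 actL coactL actR coactR
  eps2_actR : ax_eps2_actR k B1 B2 m1 eta1 delta1 eps1 m2 eta2 delta2 eps2 actL coactL actR coactR
  eps1_actL : ax_eps1_actL k B1 B2 m1 eta1 delta1 eps1 m2 eta2 delta2 eps2 actL coactL actR coactR
  actL_eta1 : ax_actL_eta1 k B1 B2 m1 eta1 delta1 eps1 m2 eta2 delta2 eps2 actL coactL actR coactR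
  coactR_eps2 : ax_coactR_eps2 k B1 B2 m1 eta1 delta1 eps1 m2 eta2 delta2 eps2 actL coactL actR coactR
  coactR_eta2 : ax_coactR_eta2 k B1 B2 m1 eta1 delta1 eps1 m2 eta2 delta2 eps2 actL coactL actR coactR
  coactL_eta1 : ax_coactL_eta1 k B1 B2 m1 eta1 delta1 eps1 m2 eta2 delta2 eps2 actL coactL actR coactR
  algCoalg1 : ax_algCoalg1 k B1 B2 m1 eta1 delta1 eps1 m2 eta2 delta2 eps2 actL coactL actR coactR
  algCoalg2 : ax_algCoalg2 k B1 B2 m1 eta1 delta1 eps1 m2 eta2 delta2 eps2 actL coactL actR coactR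
  modComod : ax_modComod k B1 B2 m1 eta1 delta1 eps1 m2 eta2 delta2 eps2 actL coactL actR coactR
  modAlg1 : ax_modAlg1 k B1 B2 m1 eta1 delta1 eps1 m2 eta2 delta2 eps2 actL coactL actR coactR
  modAlg2 : ax_modAlg2 k B1 B2 m1 eta1 delta1 eps1 m2 eta2 delta2 eps2 actL coactL actR coactR
  comodCoalg1 : ax_comodCoalg1 k B1 B2 m1 eta1 delta1 eps1 m2 eta2 delta2 eps2 actL coactL actR coactR
  comodCoalg2 : ax_comodCoalg2 k B1 B2 m1 eta1 delta1 eps1 m2 eta2 delta2 eps2 actL coactL actR coactR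
  modCoalg1 : ax_modCoalg1 k B1 B2 m1 eta1 delta1 eps1 m2 eta2 delta2 eps2 actL coactL actR coactR
  modCoalg2 : ax_modCoalg2 k B1 B2 m1 eta1 delta1 eps1 m2 eta2 delta2 eps2 actL coactL actR coactR
  comodAlg1 : ax_comodAlg1 k B1 B2 m1 eta1 delta1 eps1 m2 eta2 delta2 eps2 actL coactL actR coactR
  comodAlg2 : ax_comodAlg2 k B1 B2 m1 eta1 delta1 eps1 m2 eta2 delta2 eps2 actL coactL actR coactR

end HopfDatumSection


section Derived
variable {k : Type*} [CommRing k] {B1 B2 : Type*}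
  [AddCommMonoid B1] [Module k B1] [AddCommMonoid B2] [Module k B2]

/-- `φ₂₁ = (μ_l ⊗ μ_r) ∘ (id ⊗ τ ⊗ id) ∘ (Δ₂ ⊗ Δ₁)` -/
noncomputable def mpPhi21 (delta1 : B1 →ₗ[k] (B1 ⊗[k] B1)) (delta2 : B2 →ₗ[k] (B2 ⊗[k] B2))
    (actL : (B2 ⊗[k] B1) →ₗ[k] B1) (actR : (B2 ⊗[k] B1) →ₗ[k] B2) :
    (B2 ⊗[k] B1) →ₗ[k] (B1 ⊗[k] B2) :=
  ((skp actR) : (B1 ⊗[k] (B2 ⊗[k] B1)) →ₗ[k] (B1 ⊗[k] B2))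
      ∘ₗ ((merge2 actL) : (B2 ⊗[k] (B1 ⊗[k] (B2 ⊗[k] B1))) →ₗ[k] (B1 ⊗[k] (B2 ⊗[k] B1)))
      ∘ₗ ((skp swap2) : (B2 ⊗[k] (B2 ⊗[k] (B1 ⊗[k] B1))) →ₗ[k] (B2 ⊗[k] (B1 ⊗[k] (B2 ⊗[k] B1))))
      ∘ₗ ((skp (skp delta1)) : (B2 ⊗[k] (B2 ⊗[k] B1)) →ₗ[k] (B2 ⊗[k] (B2 ⊗[k] (B1 ⊗[k] B1))))
      ∘ₗ ((split2 delta2) : (B2 ⊗[k] B1) →ₗ[k] (B2 ⊗[k] (B2 ⊗[k] B1)))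

/-- `φ₁₂ = (m₂ ⊗ m₁) ∘ (id ⊗ τ ⊗ id) ∘ (ν_l ⊗ ν_r)` -/
noncomputable def mpPhi12 (m1 : (B1 ⊗[k] B1) →ₗ[k] B1) (m2 : (B2 ⊗[k] B2) →ₗ[k] B2)
    (coactL : B1 →ₗ[k] (B2 ⊗[k] B1)) (coactR : B2 →ₗ[k] (B2 ⊗[k] B1)) :
    (B1 ⊗[k] B2) →ₗ[k] (B2 ⊗[k] B1) :=
  ((skp m1) : (B2 ⊗[k] (B1 ⊗[k] B1)) →ₗ[k] (B2 ⊗[k] B1))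
      ∘ₗ ((merge2 m2) : (B2 ⊗[k] (B2 ⊗[k] (B1 ⊗[k] B1))) →ₗ[k] (B2 ⊗[k] (B1 ⊗[k] B1)))
      ∘ₗ ((skp swap2) : (B2 ⊗[k] (B1 ⊗[k] (B2 ⊗[k] B1))) →ₗ[k] (B2 ⊗[k] (B2 ⊗[k] (B1 ⊗[k] B1))))
      ∘ₗ ((skp (skp coactR)) : (B2 ⊗[k] (B1 ⊗[k] B2)) →ₗ[k] (B2 ⊗[k] (B1 ⊗[k] (B2 ⊗[k] B1))))
      ∘ₗ ((split2 coactL) : (B1 ⊗[k] B2) →ₗ[k] (B2 ⊗[k] (B1 ⊗[k] B2)))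


variable (hd : HopfDatum k B1 B2)

/-- the morphism `φ₂₁` canonically associated with a Hopf datum -/
noncomputable def hdPhi21 : (B2 ⊗[k] B1) →ₗ[k] (B1 ⊗[k] B2) :=
  mpPhi21 hd.delta1 hd.delta2 hd.actL hd.actR

/-- the morphism `φ₁₂` canonically associated with a Hopf datum -/
noncomputable def hdPhi12 : (B1 ⊗[k] B2) →ₗ[k] (B2 ⊗[k] B1) :=
  mpPhi12 hd.m1 hd.m2 hd.coactL hd.coactR

/-- the multiplication on `B₁ ⊗ B₂` associated with a Hopf datum (Proposition 2.6) -/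
noncomputable def hdMul : ((B1 ⊗[k] B2) ⊗[k] (B1 ⊗[k] B2)) →ₗ[k] (B1 ⊗[k] B2) :=
  crossMul hd.m1 hd.m2 (hdPhi21 hd)

/-- the unit on `B₁ ⊗ B₂` associated with a Hopf datum -/
noncomputable def hdUnit : k →ₗ[k] (B1 ⊗[k] B2) := crossUnit hd.eta1 hd.eta2

/-- the comultiplication on `B₁ ⊗ B₂` associated with a Hopf datum (Proposition 2.6) -/
noncomputable def hdComul : (B1 ⊗[k] B2) →ₗ[k] ((B1 ⊗[k] B2) ⊗[k] (B1 ⊗[k] B2)) :=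
  crossComul hd.delta1 hd.delta2 (hdPhi12 hd)

/-- the counit on `B₁ ⊗ B₂` associated with a Hopf datum -/
noncomputable def hdCounit : (B1 ⊗[k] B2) →ₗ[k] k := crossCounit hd.eps1 hd.eps2

/-- the idempotent `π = (η₁ ∘ ε₁) ⊗ id ⊗ id ⊗ (η₂ ∘ ε₂)` on `B₁ ⊗ B₂ ⊗ B₁ ⊗ B₂` -/
noncomputable def piMap : (B1 ⊗[k] (B2 ⊗[k] (B1 ⊗[k] B2))) →ₗ[k]
    (B1 ⊗[k] (B2 ⊗[k] (B1 ⊗[k] B2))) :=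
  TensorProduct.map (hd.eta1 ∘ₗ hd.eps1)
    (TensorProduct.map LinearMap.id (TensorProduct.map LinearMap.id (hd.eta2 ∘ₗ hd.eps2)))

/-- the recursion operator `Φ` of Definition 2.10 / eq. (2.11) of Bespalov-Drabant,
"Cross Product Bialgebras I", associated with a Hopf datum -/
noncomputable def Phi (f : (B1 ⊗[k] (B2 ⊗[k] (B1 ⊗[k] B2))) →ₗ[k]
    (B1 ⊗[k] (B2 ⊗[k] (B1 ⊗[k] B2)))) :
    (B1 ⊗[k] (B2 ⊗[k] (B1 ⊗[k] B2))) →ₗ[k] (B1 ⊗[k] (B2 ⊗[k] (B1 ⊗[k] B2))) :=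
  ((skp (skp (merge2 hd.m1))) : (B1 ⊗[k] (B2 ⊗[k] (B1 ⊗[k] (B1 ⊗[k] B2)))) →ₗ[k] (B1 ⊗[k] (B2 ⊗[k] (B1 ⊗[k] B2))))
      ∘ₗ ((skp (merge2 hd.m2)) : (B1 ⊗[k] (B2 ⊗[k] (B2 ⊗[k] (B1 ⊗[k] (B1 ⊗[k] B2))))) →ₗ[k] (B1 ⊗[k] (B2 ⊗[k] (B1 ⊗[k] (B1 ⊗[k] B2)))))
      ∘ₗ ((skp (skp (skp (skp (merge2 hd.m1))))) : (B1 ⊗[k] (B2 ⊗[k] (B2 ⊗[k] (B1 ⊗[k] (B1 ⊗[k] (B1 ⊗[k] B2)))))) →ₗ[k] (B1 ⊗[k] (B2 ⊗[k] (B2 ⊗[k] (B1 ⊗[k] (B1 ⊗[k] B2))))))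
      ∘ₗ ((skp (skp swap2)) : (B1 ⊗[k] (B2 ⊗[k] (B1 ⊗[k] (B2 ⊗[k] (B1 ⊗[k] (B1 ⊗[k] B2)))))) →ₗ[k] (B1 ⊗[k] (B2 ⊗[k] (B2 ⊗[k] (B1 ⊗[k] (B1 ⊗[k] (B1 ⊗[k] B2)))))))
      ∘ₗ ((skp (merge2 hd.m2)) : (B1 ⊗[k] (B2 ⊗[k] (B2 ⊗[k] (B1 ⊗[k] (B2 ⊗[k] (B1 ⊗[k] (B1 ⊗[k] B2))))))) →ₗ[k] (B1 ⊗[k] (B2 ⊗[k] (B1 ⊗[k] (B2 ⊗[k] (B1 ⊗[k] (B1 ⊗[k] B2)))))))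
      ∘ₗ ((skp (skp (skp (skp (skp (skp (merge2 hd.actL))))))) : (B1 ⊗[k] (B2 ⊗[k] (B2 ⊗[k] (B1 ⊗[k] (B2 ⊗[k] (B1 ⊗[k] (B2 ⊗[k] (B1 ⊗[k] B2)))))))) →ₗ[k] (B1 ⊗[k] (B2 ⊗[k] (B2 ⊗[k] (B1 ⊗[k] (B2 ⊗[k] (B1 ⊗[k] (B1 ⊗[k] B2))))))))
      ∘ₗ ((skp (skp (skp (skp swap2)))) : (B1 ⊗[k] (B2 ⊗[k] (B2 ⊗[k] (B1 ⊗[k] (B1 ⊗[k] (B2 ⊗[k] (B2 ⊗[k] (B1 ⊗[k] B2)))))))) →ₗ[k] (B1 ⊗[k] (B2 ⊗[k] (B2 ⊗[k] (B1 ⊗[k] (B2 ⊗[k] (B1 ⊗[k] (B2 ⊗[k] (B1 ⊗[k] B2)))))))))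
      ∘ₗ ((skp (skp swap2)) : (B1 ⊗[k] (B2 ⊗[k] (B1 ⊗[k] (B2 ⊗[k] (B1 ⊗[k] (B2 ⊗[k] (B2 ⊗[k] (B1 ⊗[k] B2)))))))) →ₗ[k] (B1 ⊗[k] (B2 ⊗[k] (B2 ⊗[k] (B1 ⊗[k] (B1 ⊗[k] (B2 ⊗[k] (B2 ⊗[k] (B1 ⊗[k] B2)))))))))
      ∘ₗ ((skp (merge2 hd.actR)) : (B1 ⊗[k] (B2 ⊗[k] (B1 ⊗[k] (B1 ⊗[k] (B2 ⊗[k] (B1 ⊗[k] (B2 ⊗[k] (B2 ⊗[k] (B1 ⊗[k] B2))))))))) →ₗ[k] (B1 ⊗[k] (B2 ⊗[k] (B1 ⊗[k] (B2 ⊗[k] (B1 ⊗[k] (B2 ⊗[k] (B2 ⊗[k] (B1 ⊗[k] B2)))))))))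
      ∘ₗ ((skp (skp (skp (skp (skp (skp (skp (skp (skp hd.m2))))))))) : (B1 ⊗[k] (B2 ⊗[k] (B1 ⊗[k] (B1 ⊗[k] (B2 ⊗[k] (B1 ⊗[k] (B2 ⊗[k] (B2 ⊗[k] (B1 ⊗[k] (B2 ⊗[k] B2)))))))))) →ₗ[k] (B1 ⊗[k] (B2 ⊗[k] (B1 ⊗[k] (B1 ⊗[k] (B2 ⊗[k] (B1 ⊗[k] (B2 ⊗[k] (B2 ⊗[k] (B1 ⊗[k] B2))))))))))
      ∘ₗ ((skp (skp (skp (skp (skp (skp swap2)))))) : (B1 ⊗[k] (B2 ⊗[k] (B1 ⊗[k] (B1 ⊗[k] (B2 ⊗[k] (B1 ⊗[k] (B2 ⊗[k] (B2 ⊗[k] (B1 ⊗[k] (B2 ⊗[k] B2)))))))))) →ₗ[k] (B1 ⊗[k] (B2 ⊗[k] (B1 ⊗[k] (B1 ⊗[k] (B2 ⊗[k] (B1 ⊗[k] (B2 ⊗[k] (B2 ⊗[k] (B1 ⊗[k] (B2 ⊗[k] B2)))))))))))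
      ∘ₗ ((skp (skp swap2)) : (B1 ⊗[k] (B2 ⊗[k] (B1 ⊗[k] (B1 ⊗[k] (B2 ⊗[k] (B1 ⊗[k] (B2 ⊗[k] (B2 ⊗[k] (B1 ⊗[k] (B2 ⊗[k] B2)))))))))) →ₗ[k] (B1 ⊗[k] (B2 ⊗[k] (B1 ⊗[k] (B1 ⊗[k] (B2 ⊗[k] (B1 ⊗[k] (B2 ⊗[k] (B2 ⊗[k] (B1 ⊗[k] (B2 ⊗[k] B2)))))))))))
      ∘ₗ ((merge2 hd.m1) : (B1 ⊗[k] (B1 ⊗[k] (B2 ⊗[k] (B1 ⊗[k] (B1 ⊗[k] (B2 ⊗[k] (B1 ⊗[k] (B2 ⊗[k] (B2 ⊗[k] (B1 ⊗[k] (B2 ⊗[k] B2))))))))))) →ₗ[k] (B1 ⊗[k] (B2 ⊗[k] (B1 ⊗[k] (B1 ⊗[k] (B2 ⊗[k] (B1 ⊗[k] (B2 ⊗[k] (B2 ⊗[k] (B1 ⊗[k] (B2 ⊗[k] B2)))))))))))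
      ∘ₗ ((skp (skp (skp (skp (skp (skp (skp (skp (skp (skp (merge2 hd.actR))))))))))) : (B1 ⊗[k] (B1 ⊗[k] (B2 ⊗[k] (B1 ⊗[k] (B1 ⊗[k] (B2 ⊗[k] (B1 ⊗[k] (B2 ⊗[k] (B2 ⊗[k] (B1 ⊗[k] (B2 ⊗[k] (B1 ⊗[k] B2)))))))))))) →ₗ[k] (B1 ⊗[k] (B1 ⊗[k] (B2 ⊗[k] (B1 ⊗[k] (B1 ⊗[k] (B2 ⊗[k] (B1 ⊗[k] (B2 ⊗[k] (B2 ⊗[k] (B1 ⊗[k] (B2 ⊗[k] B2))))))))))))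
      ∘ₗ ((skp (skp (skp (skp (skp (skp (skp (skp (split2 hd.coactR))))))))) : (B1 ⊗[k] (B1 ⊗[k] (B2 ⊗[k] (B1 ⊗[k] (B1 ⊗[k] (B2 ⊗[k] (B1 ⊗[k] (B2 ⊗[k] (B2 ⊗[k] (B2 ⊗[k] (B1 ⊗[k] B2))))))))))) →ₗ[k] (B1 ⊗[k] (B1 ⊗[k] (B2 ⊗[k] (B1 ⊗[k] (B1 ⊗[k] (B2 ⊗[k] (B1 ⊗[k] (B2 ⊗[k] (B2 ⊗[k] (B1 ⊗[k] (B2 ⊗[k] (B1 ⊗[k] B2)))))))))))))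
      ∘ₗ ((skp (skp (split2 hd.coactL))) : (B1 ⊗[k] (B1 ⊗[k] (B1 ⊗[k] (B1 ⊗[k] (B2 ⊗[k] (B1 ⊗[k] (B2 ⊗[k] (B2 ⊗[k] (B2 ⊗[k] (B1 ⊗[k] B2)))))))))) →ₗ[k] (B1 ⊗[k] (B1 ⊗[k] (B2 ⊗[k] (B1 ⊗[k] (B1 ⊗[k] (B2 ⊗[k] (B1 ⊗[k] (B2 ⊗[k] (B2 ⊗[k] (B2 ⊗[k] (B1 ⊗[k] B2))))))))))))
      ∘ₗ ((skp (merge2 hd.actL)) : (B1 ⊗[k] (B2 ⊗[k] (B1 ⊗[k] (B1 ⊗[k] (B1 ⊗[k] (B2 ⊗[k] (B1 ⊗[k] (B2 ⊗[k] (B2 ⊗[k] (B2 ⊗[k] (B1 ⊗[k] B2))))))))))) →ₗ[k] (B1 ⊗[k] (B1 ⊗[k] (B1 ⊗[k] (B1 ⊗[k] (B2 ⊗[k] (B1 ⊗[k] (B2 ⊗[k] (B2 ⊗[k] (B2 ⊗[k] (B1 ⊗[k] B2)))))))))))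
      ∘ₗ ((skp (skp (skp (skp (skp (skp (skp (skp swap2)))))))) : (B1 ⊗[k] (B2 ⊗[k] (B1 ⊗[k] (B1 ⊗[k] (B1 ⊗[k] (B2 ⊗[k] (B1 ⊗[k] (B2 ⊗[k] (B2 ⊗[k] (B2 ⊗[k] (B1 ⊗[k] B2))))))))))) →ₗ[k] (B1 ⊗[k] (B2 ⊗[k] (B1 ⊗[k] (B1 ⊗[k] (B1 ⊗[k] (B2 ⊗[k] (B1 ⊗[k] (B2 ⊗[k] (B2 ⊗[k] (B2 ⊗[k] (B1 ⊗[k] B2))))))))))))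
      ∘ₗ ((skp (skp (skp (skp (apply4 f))))) : (B1 ⊗[k] (B2 ⊗[k] (B1 ⊗[k] (B1 ⊗[k] (B1 ⊗[k] (B2 ⊗[k] (B1 ⊗[k] (B2 ⊗[k] (B2 ⊗[k] (B2 ⊗[k] (B1 ⊗[k] B2))))))))))) →ₗ[k] (B1 ⊗[k] (B2 ⊗[k] (B1 ⊗[k] (B1 ⊗[k] (B1 ⊗[k] (B2 ⊗[k] (B1 ⊗[k] (B2 ⊗[k] (B2 ⊗[k] (B2 ⊗[k] (B1 ⊗[k] B2))))))))))))
      ∘ₗ ((skp (skp swap2)) : (B1 ⊗[k] (B2 ⊗[k] (B1 ⊗[k] (B1 ⊗[k] (B1 ⊗[k] (B2 ⊗[k] (B1 ⊗[k] (B2 ⊗[k] (B2 ⊗[k] (B2 ⊗[k] (B1 ⊗[k] B2))))))))))) →ₗ[k] (B1 ⊗[k] (B2 ⊗[k] (B1 ⊗[k] (B1 ⊗[k] (B1 ⊗[k] (B2 ⊗[k] (B1 ⊗[k] (B2 ⊗[k] (B2 ⊗[k] (B2 ⊗[k] (B1 ⊗[k] B2))))))))))))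
      ∘ₗ ((skp (skp (skp (skp (skp (skp (skp (skp (skp (split2 hd.coactR)))))))))) : (B1 ⊗[k] (B2 ⊗[k] (B1 ⊗[k] (B1 ⊗[k] (B1 ⊗[k] (B2 ⊗[k] (B1 ⊗[k] (B2 ⊗[k] (B2 ⊗[k] (B2 ⊗[k] B2)))))))))) →ₗ[k] (B1 ⊗[k] (B2 ⊗[k] (B1 ⊗[k] (B1 ⊗[k] (B1 ⊗[k] (B2 ⊗[k] (B1 ⊗[k] (B2 ⊗[k] (B2 ⊗[k] (B2 ⊗[k] (B1 ⊗[k] B2))))))))))))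
      ∘ₗ ((skp (skp (skp (skp (skp (skp (skp (skp (merge2 hd.actR))))))))) : (B1 ⊗[k] (B2 ⊗[k] (B1 ⊗[k] (B1 ⊗[k] (B1 ⊗[k] (B2 ⊗[k] (B1 ⊗[k] (B2 ⊗[k] (B2 ⊗[k] (B1 ⊗[k] (B2 ⊗[k] B2))))))))))) →ₗ[k] (B1 ⊗[k] (B2 ⊗[k] (B1 ⊗[k] (B1 ⊗[k] (B1 ⊗[k] (B2 ⊗[k] (B1 ⊗[k] (B2 ⊗[k] (B2 ⊗[k] (B2 ⊗[k] B2)))))))))))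
      ∘ₗ ((skp (skp (skp (merge2 hd.actL)))) : (B1 ⊗[k] (B2 ⊗[k] (B1 ⊗[k] (B2 ⊗[k] (B1 ⊗[k] (B1 ⊗[k] (B2 ⊗[k] (B1 ⊗[k] (B2 ⊗[k] (B2 ⊗[k] (B1 ⊗[k] (B2 ⊗[k] B2)))))))))))) →ₗ[k] (B1 ⊗[k] (B2 ⊗[k] (B1 ⊗[k] (B1 ⊗[k] (B1 ⊗[k] (B2 ⊗[k] (B1 ⊗[k] (B2 ⊗[k] (B2 ⊗[k] (B1 ⊗[k] (B2 ⊗[k] B2))))))))))))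
      ∘ₗ ((skp (split2 hd.coactL)) : (B1 ⊗[k] (B1 ⊗[k] (B2 ⊗[k] (B1 ⊗[k] (B1 ⊗[k] (B2 ⊗[k] (B1 ⊗[k] (B2 ⊗[k] (B2 ⊗[k] (B1 ⊗[k] (B2 ⊗[k] B2))))))))))) →ₗ[k] (B1 ⊗[k] (B2 ⊗[k] (B1 ⊗[k] (B2 ⊗[k] (B1 ⊗[k] (B1 ⊗[k] (B2 ⊗[k] (B1 ⊗[k] (B2 ⊗[k] (B2 ⊗[k] (B1 ⊗[k] (B2 ⊗[k] B2)))))))))))))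
      ∘ₗ ((skp (skp (skp (skp (skp (skp (skp (skp (skp (skp hd.delta2)))))))))) : (B1 ⊗[k] (B1 ⊗[k] (B2 ⊗[k] (B1 ⊗[k] (B1 ⊗[k] (B2 ⊗[k] (B1 ⊗[k] (B2 ⊗[k] (B2 ⊗[k] (B1 ⊗[k] B2)))))))))) →ₗ[k] (B1 ⊗[k] (B1 ⊗[k] (B2 ⊗[k] (B1 ⊗[k] (B1 ⊗[k] (B2 ⊗[k] (B1 ⊗[k] (B2 ⊗[k] (B2 ⊗[k] (B1 ⊗[k] (B2 ⊗[k] B2))))))))))))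
      ∘ₗ ((skp (skp (skp (skp (skp (skp (skp swap2))))))) : (B1 ⊗[k] (B1 ⊗[k] (B2 ⊗[k] (B1 ⊗[k] (B1 ⊗[k] (B2 ⊗[k] (B1 ⊗[k] (B2 ⊗[k] (B2 ⊗[k] (B1 ⊗[k] B2)))))))))) →ₗ[k] (B1 ⊗[k] (B1 ⊗[k] (B2 ⊗[k] (B1 ⊗[k] (B1 ⊗[k] (B2 ⊗[k] (B1 ⊗[k] (B2 ⊗[k] (B2 ⊗[k] (B1 ⊗[k] B2)))))))))))
      ∘ₗ ((skp (skp (skp swap2))) : (B1 ⊗[k] (B1 ⊗[k] (B2 ⊗[k] (B1 ⊗[k] (B1 ⊗[k] (B2 ⊗[k] (B1 ⊗[k] (B2 ⊗[k] (B2 ⊗[k] (B1 ⊗[k] B2)))))))))) →ₗ[k] (B1 ⊗[k] (B1 ⊗[k] (B2 ⊗[k] (B1 ⊗[k] (B1 ⊗[k] (B2 ⊗[k] (B1 ⊗[k] (B2 ⊗[k] (B2 ⊗[k] (B1 ⊗[k] B2)))))))))))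
      ∘ₗ ((split2 hd.delta1) : (B1 ⊗[k] (B2 ⊗[k] (B1 ⊗[k] (B1 ⊗[k] (B2 ⊗[k] (B1 ⊗[k] (B2 ⊗[k] (B2 ⊗[k] (B1 ⊗[k] B2))))))))) →ₗ[k] (B1 ⊗[k] (B1 ⊗[k] (B2 ⊗[k] (B1 ⊗[k] (B1 ⊗[k] (B2 ⊗[k] (B1 ⊗[k] (B2 ⊗[k] (B2 ⊗[k] (B1 ⊗[k] B2)))))))))))
      ∘ₗ ((skp (skp (skp (skp (skp (skp (skp (split2 hd.coactL)))))))) : (B1 ⊗[k] (B2 ⊗[k] (B1 ⊗[k] (B1 ⊗[k] (B2 ⊗[k] (B1 ⊗[k] (B2 ⊗[k] (B1 ⊗[k] B2)))))))) →ₗ[k] (B1 ⊗[k] (B2 ⊗[k] (B1 ⊗[k] (B1 ⊗[k] (B2 ⊗[k] (B1 ⊗[k] (B2 ⊗[k] (B2 ⊗[k] (B1 ⊗[k] B2))))))))))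
      ∘ₗ ((skp (skp (skp (skp (skp swap2))))) : (B1 ⊗[k] (B2 ⊗[k] (B1 ⊗[k] (B1 ⊗[k] (B2 ⊗[k] (B2 ⊗[k] (B1 ⊗[k] (B1 ⊗[k] B2)))))))) →ₗ[k] (B1 ⊗[k] (B2 ⊗[k] (B1 ⊗[k] (B1 ⊗[k] (B2 ⊗[k] (B1 ⊗[k] (B2 ⊗[k] (B1 ⊗[k] B2)))))))))
      ∘ₗ ((skp (skp (skp swap2))) : (B1 ⊗[k] (B2 ⊗[k] (B1 ⊗[k] (B2 ⊗[k] (B1 ⊗[k] (B2 ⊗[k] (B1 ⊗[k] (B1 ⊗[k] B2)))))))) →ₗ[k] (B1 ⊗[k] (B2 ⊗[k] (B1 ⊗[k] (B1 ⊗[k] (B2 ⊗[k] (B2 ⊗[k] (B1 ⊗[k] (B1 ⊗[k] B2)))))))))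
      ∘ₗ ((skp (split2 hd.coactR)) : (B1 ⊗[k] (B2 ⊗[k] (B2 ⊗[k] (B1 ⊗[k] (B2 ⊗[k] (B1 ⊗[k] (B1 ⊗[k] B2))))))) →ₗ[k] (B1 ⊗[k] (B2 ⊗[k] (B1 ⊗[k] (B2 ⊗[k] (B1 ⊗[k] (B2 ⊗[k] (B1 ⊗[k] (B1 ⊗[k] B2)))))))))
      ∘ₗ ((skp (skp (skp (skp (skp (split2 hd.delta1)))))) : (B1 ⊗[k] (B2 ⊗[k] (B2 ⊗[k] (B1 ⊗[k] (B2 ⊗[k] (B1 ⊗[k] B2)))))) →ₗ[k] (B1 ⊗[k] (B2 ⊗[k] (B2 ⊗[k] (B1 ⊗[k] (B2 ⊗[k] (B1 ⊗[k] (B1 ⊗[k] B2))))))))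
      ∘ₗ ((skp (skp (skp swap2))) : (B1 ⊗[k] (B2 ⊗[k] (B2 ⊗[k] (B2 ⊗[k] (B1 ⊗[k] (B1 ⊗[k] B2)))))) →ₗ[k] (B1 ⊗[k] (B2 ⊗[k] (B2 ⊗[k] (B1 ⊗[k] (B2 ⊗[k] (B1 ⊗[k] B2)))))))
      ∘ₗ ((skp (split2 hd.delta2)) : (B1 ⊗[k] (B2 ⊗[k] (B2 ⊗[k] (B1 ⊗[k] (B1 ⊗[k] B2))))) →ₗ[k] (B1 ⊗[k] (B2 ⊗[k] (B2 ⊗[k] (B2 ⊗[k] (B1 ⊗[k] (B1 ⊗[k] B2)))))))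
      ∘ₗ ((skp (skp (skp (split2 hd.delta1)))) : (B1 ⊗[k] (B2 ⊗[k] (B2 ⊗[k] (B1 ⊗[k] B2)))) →ₗ[k] (B1 ⊗[k] (B2 ⊗[k] (B2 ⊗[k] (B1 ⊗[k] (B1 ⊗[k] B2))))))
      ∘ₗ ((skp (split2 hd.delta2)) : (B1 ⊗[k] (B2 ⊗[k] (B1 ⊗[k] B2))) →ₗ[k] (B1 ⊗[k] (B2 ⊗[k] (B2 ⊗[k] (B1 ⊗[k] B2)))))

end Derived

end CPB

set_option linter.unusedSimpArgs false

/-!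
Outline of the argument. Words in `B₁` and `B₂` are written as right-nested tensor products, and
maps are evaluated on pure tensors by means of the `_tmul` lemmas. Whenever a structure map produces
a sum, we generalise that sum to an arbitrary tensor and invoke `pureInd`, which imitates the
style of Sweedler: after the call one may pretend that a single summand is present.

The mathematical content is concentrated in two sliding laws, `c1` and `c2`, saying how `φ₁₂`
commutes with `Δ₁` and `Δ₂` respectively. They are exactly what makes a cosmash-type coproduct
coassociative. Each is shown by rewriting both of its sides into a common normal form, namely
a value of the multiplication pattern `psi1` (or `psi2`), whose arguments can then be compared
letter by letter.
-/

namespace CPB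

section Helpers
variable {k : Type*} [CommRing k]
variable {A B C D R R' : Type*}
  [AddCommMonoid A] [Module k A] [AddCommMonoid B] [Module k B]
  [AddCommMonoid C] [Module k C] [AddCommMonoid D] [Module k D]
  [AddCommMonoid R] [Module k R] [AddCommMonoid R'] [Module k R']

/-- Evaluation of `skp` on a pure tensor: the head stays put and the tail is transformed. -/
theorem skp_tmul (g : R →ₗ[k] R') (a : A) (r : R) :
    skp g (a ⊗ₜ[k] r) = a ⊗ₜ[k] g r := rfl

/-- Evaluation of `pair2`: the operation eats the two leading strands, and its output is then
re-bracketed to the right so that later operations again see a right-nested word. -/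
theorem pair2_tmul (op : (A ⊗[k] B) →ₗ[k] (C ⊗[k] D)) (a : A) (b : B) (r : R) :
    pair2 op (a ⊗ₜ[k] (b ⊗ₜ[k] r)) = TensorProduct.assoc k C D R (op (a ⊗ₜ[k] b) ⊗ₜ[k] r) := rfl

/-- Evaluation of `merge2`, which shortens a word by multiplying its first two letters. -/
theorem merge2_tmul (m : (A ⊗[k] B) →ₗ[k] C) (a : A) (b : B) (r : R) :
    merge2 m (a ⊗ₜ[k] (b ⊗ₜ[k] r)) = m (a ⊗ₜ[k] b) ⊗ₜ[k] r := rfl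

/-- Evaluation of `split2`, which lengthens a word. Unlike merging, the outcome need not be pure,
hence the explicit associator. -/
theorem split2_tmul (d : A →ₗ[k] (C ⊗[k] D)) (a : A) (r : R) :
    split2 d (a ⊗ₜ[k] r) = TensorProduct.assoc k C D R (d a ⊗ₜ[k] r) := rfl

/-- Evaluation of the transposition of adjacent letters. -/
theorem swap2_tmul (a : A) (b : B) (r : R) :
    swap2 (a ⊗ₜ[k] (b ⊗ₜ[k] r)) = b ⊗ₜ[k] (a ⊗ₜ[k] r) := rfl

/-- flatten a right-nested triple followed by a tail -/
noncomputable def flat3 :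
    ((A ⊗[k] (B ⊗[k] C)) ⊗[k] R) →ₗ[k] (A ⊗[k] (B ⊗[k] (C ⊗[k] R))) :=
  (skp (TensorProduct.assoc k B C R).toLinearMap) ∘ₗ
    (TensorProduct.assoc k A (B ⊗[k] C) R).toLinearMap

/-- Definitional unfolding for `flat3`. -/
theorem flat3_tmul (a : A) (b : B) (c : C) (r : R) :
    flat3 ((a ⊗ₜ[k] (b ⊗ₜ[k] c)) ⊗ₜ[k] r) = a ⊗ₜ[k] (b ⊗ₜ[k] (c ⊗ₜ[k] r)) := rfl


/-- Mathlib's `TensorProduct.assoc_tmul`, restated so that the bracketing used below is visible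
and `simp only` does not have to unfold any coercion. -/
theorem assoc_t (a : A) (b : B) (c : C) :
    TensorProduct.assoc k A B C ((a ⊗ₜ[k] b) ⊗ₜ[k] c) = a ⊗ₜ[k] (b ⊗ₜ[k] c) := rfl

/-- The inverse associator on a word of length three. -/
theorem assoc_symm_t (a : A) (b : B) (c : C) :
    (TensorProduct.assoc k A B C).symm (a ⊗ₜ[k] (b ⊗ₜ[k] c)) = (a ⊗ₜ[k] b) ⊗ₜ[k] c := rfl

/-- Induction on a tensor for goals which are equations between additive expressions in it:
only the case of pure tensors is left, the other two being closed by additivity. -/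
theorem pureInd {motive : A ⊗[k] B → Prop}
    (pure : ∀ x y, motive (x ⊗ₜ[k] y))
    (zero : motive 0 := by simp only [tmul_zero, zero_tmul, map_zero, smul_zero])
    (sum : ∀ u v, motive u → motive v → motive (u + v) := by
      intro u v hu hv
      simp only [tmul_add, add_tmul, map_add, smul_add, hu, hv]) :
    ∀ t, motive t :=
  fun t => TensorProduct.induction_on t zero pure sum

end Helpers

section Main
variable {k : Type*} [CommRing k] {B1 B2 : Type*}
  [AddCommMonoid B1] [Module k B1] [AddCommMonoid B2] [Module k B2]

/-- assemble the six strands of the iterated comultiplication -/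
noncomputable def omega (phi : (B1 ⊗[k] B2) →ₗ[k] (B2 ⊗[k] B1)) :
    ((B1 ⊗[k] (B1 ⊗[k] B1)) ⊗[k] (B2 ⊗[k] (B2 ⊗[k] B2))) →ₗ[k]
      (B1 ⊗[k] (B2 ⊗[k] (B1 ⊗[k] (B2 ⊗[k] (B1 ⊗[k] B2))))) :=
  skp (skp (skp (pair2 phi))) ∘ₗ skp (pair2 phi) ∘ₗ skp (skp (pair2 phi)) ∘ₗ flat3

/-- regroup six strands as three pairs -/
noncomputable def regroup :
    (B1 ⊗[k] (B2 ⊗[k] (B1 ⊗[k] (B2 ⊗[k] (B1 ⊗[k] B2))))) →ₗ[k]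
      ((B1 ⊗[k] B2) ⊗[k] ((B1 ⊗[k] B2) ⊗[k] (B1 ⊗[k] B2))) :=
  skp (TensorProduct.assoc k B1 B2 (B1 ⊗[k] B2)).symm.toLinearMap ∘ₗ
    (TensorProduct.assoc k B1 B2 (B1 ⊗[k] (B2 ⊗[k] (B1 ⊗[k] B2)))).symm.toLinearMap

/-- On pure tensors nothing happens except for moving parentheses. -/
theorem regroup_tmul (a : B1) (b : B2) (c : B1) (d : B2) (e : B1) (f : B2) :
    regroup (a ⊗ₜ[k] (b ⊗ₜ[k] (c ⊗ₜ[k] (d ⊗ₜ[k] (e ⊗ₜ[k] f))))) =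
      (a ⊗ₜ[k] b) ⊗ₜ[k] ((c ⊗ₜ[k] d) ⊗ₜ[k] (e ⊗ₜ[k] f)) := rfl

/-- Unfolding the cross comultiplication: first cut `a` by means of `Δ₁`, next cut `b` with `Δ₂`,
and finally let the two middle legs cross each other through `phi`. -/
theorem crossComul_tmul (delta1 : B1 →ₗ[k] (B1 ⊗[k] B1)) (delta2 : B2 →ₗ[k] (B2 ⊗[k] B2))
    (phi : (B1 ⊗[k] B2) →ₗ[k] (B2 ⊗[k] B1)) (a : B1) (b : B2) :
    crossComul delta1 delta2 phi (a ⊗ₜ[k] b) =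
      (TensorProduct.assoc k B1 B2 (B1 ⊗[k] B2)).symm
        (skp (pair2 phi) (skp (skp delta2)
          (TensorProduct.assoc k B1 B1 B2 (delta1 a ⊗ₜ[k] b)))) := rfl


/-- Applying the cross comultiplication to the left output leg. Here `u` plays the role of the
crossed middle pair `phi (a₂ ⊗ b₁)`; keeping it abstract lets us argue by linearity instead of
having to decompose it prematurely. -/
theorem left_aux (delta1 : B1 →ₗ[k] (B1 ⊗[k] B1)) (delta2 : B2 →ₗ[k] (B2 ⊗[k] B2))
    (phi : (B1 ⊗[k] B2) →ₗ[k] (B2 ⊗[k] B1)) (a1 : B1) (b2 : B2) (u : B2 ⊗[k] B1) :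
    TensorProduct.assoc k _ _ _ (TensorProduct.map (crossComul delta1 delta2 phi) LinearMap.id
      ((TensorProduct.assoc k B1 B2 (B1 ⊗[k] B2)).symm
        (a1 ⊗ₜ[k] TensorProduct.assoc k B2 B1 B2 (u ⊗ₜ[k] b2)))) =
    regroup (skp (pair2 phi) (TensorProduct.assoc k B1 B1 _
      (delta1 a1 ⊗ₜ[k] flat3 (split2 delta2 u ⊗ₜ[k] b2)))) := by
  revert u; refine pureInd fun c d => ?_
  simp only [assoc_t, assoc_symm_t, TensorProduct.map_tmul, LinearMap.id_apply, crossComul_tmul,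
    split2_tmul]
  generalize delta1 a1 = t; revert t; refine pureInd fun p q => ?_
  simp only [assoc_t, assoc_symm_t, skp_tmul]
  generalize delta2 c = t; revert t; refine pureInd fun v w => ?_
  simp only [assoc_t, assoc_symm_t, skp_tmul, pair2_tmul, flat3_tmul]
  generalize phi (q ⊗ₜ[k] v) = t; revert t; refine pureInd fun x y => ?_
  simp only [assoc_t, assoc_symm_t, skp_tmul, pair2_tmul, flat3_tmul, regroup_tmul]

/-- Left bracketing of the twofold cross comultiplication. Assuming that `phi` slides through `Δ₂`
(hypothesis `h2`, a hexagon-type law), everything is expressed by the symmetric six-strand diagram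
`omega`, fed with iterated coproducts bracketed on the left. -/
theorem left_side (delta1 : B1 →ₗ[k] (B1 ⊗[k] B1)) (delta2 : B2 →ₗ[k] (B2 ⊗[k] B2))
    (phi : (B1 ⊗[k] B2) →ₗ[k] (B2 ⊗[k] B1))
    (h2 : split2 delta2 ∘ₗ phi = skp phi ∘ₗ pair2 phi ∘ₗ skp delta2) (a : B1) (b : B2) :
    TensorProduct.assoc k _ _ _ (TensorProduct.map (crossComul delta1 delta2 phi) LinearMap.id
      (crossComul delta1 delta2 phi (a ⊗ₜ[k] b))) =
    regroup (omega phi (split2 delta1 (delta1 a) ⊗ₜ[k] split2 delta2 (delta2 b))) := by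
  rw [crossComul_tmul]
  generalize delta1 a = t; revert t; refine pureInd fun a1 a2 => ?_
  simp only [assoc_t, skp_tmul]
  generalize delta2 b = t; revert t; refine pureInd fun b1 b2 => ?_
  rw [pair2_tmul, left_aux, split2_tmul, split2_tmul]
  have h := LinearMap.congr_fun h2 (a2 ⊗ₜ[k] b1)
  simp only [LinearMap.comp_apply, skp_tmul] at h
  rw [h]
  generalize delta1 a1 = t; revert t; refine pureInd fun p q => ?_
  generalize delta2 b1 = t; revert t; refine pureInd fun v w => ?_
  simp only [assoc_t, skp_tmul, pair2_tmul, omega, LinearMap.comp_apply, flat3_tmul]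
  generalize phi (a2 ⊗ₜ[k] v) = t; revert t; refine pureInd fun f g => ?_
  simp only [assoc_t, skp_tmul, pair2_tmul]
  have e : ∀ s : B2 ⊗[k] B1, pair2 phi (q ⊗ₜ[k] flat3 ((f ⊗ₜ[k] s) ⊗ₜ[k] b2)) =
      TensorProduct.assoc k B2 B1 _
        (phi (q ⊗ₜ[k] f) ⊗ₜ[k] TensorProduct.assoc k B2 B1 B2 (s ⊗ₜ[k] b2)) := by
    intro s
    revert s; refine pureInd fun h' i' => ?_
    simp only [assoc_t, pair2_tmul, flat3_tmul]
  rw [e]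
  generalize phi (q ⊗ₜ[k] f) = t; revert t; refine pureInd fun f' g' => ?_
  simp only [assoc_t, skp_tmul, pair2_tmul]

/-- Mirror image of `left_aux`: now the second output leg gets comultiplied, which only touches the
`B₁`-component of `u` together with the final letter. -/
theorem right_aux (delta1 : B1 →ₗ[k] (B1 ⊗[k] B1)) (delta2 : B2 →ₗ[k] (B2 ⊗[k] B2))
    (phi : (B1 ⊗[k] B2) →ₗ[k] (B2 ⊗[k] B1)) (a1 : B1) (b2 : B2) (u : B2 ⊗[k] B1) :
    TensorProduct.map LinearMap.id (crossComul delta1 delta2 phi)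
      ((TensorProduct.assoc k B1 B2 (B1 ⊗[k] B2)).symm
        (a1 ⊗ₜ[k] TensorProduct.assoc k B2 B1 B2 (u ⊗ₜ[k] b2))) =
    regroup (a1 ⊗ₜ[k] (skp (skp (pair2 phi)) (flat3 (skp delta1 u ⊗ₜ[k] delta2 b2)))) := by
  revert u; refine pureInd fun c d => ?_
  simp only [assoc_t, assoc_symm_t, TensorProduct.map_tmul, LinearMap.id_apply, crossComul_tmul,
    skp_tmul]
  generalize delta1 d = t; revert t; refine pureInd fun p q => ?_
  simp only [assoc_t, assoc_symm_t, skp_tmul]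
  generalize delta2 b2 = t; revert t; refine pureInd fun v w => ?_
  simp only [assoc_t, assoc_symm_t, skp_tmul, pair2_tmul, flat3_tmul]
  generalize phi (q ⊗ₜ[k] v) = t; revert t; refine pureInd fun x y => ?_
  simp only [assoc_t, assoc_symm_t, skp_tmul, pair2_tmul, flat3_tmul, regroup_tmul]

/-- Right bracketing of the twofold cross comultiplication, under the dual sliding law `h1` for
`Δ₁`. Because the diagram `omega` coincides with the one in `left_side`, coassociativity of the cross
product is thereby reduced to coassociativity of both factors. -/
theorem right_side (delta1 : B1 →ₗ[k] (B1 ⊗[k] B1)) (delta2 : B2 →ₗ[k] (B2 ⊗[k] B2))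
    (phi : (B1 ⊗[k] B2) →ₗ[k] (B2 ⊗[k] B1))
    (h1 : skp delta1 ∘ₗ phi = pair2 phi ∘ₗ skp phi ∘ₗ split2 delta1) (a : B1) (b : B2) :
    TensorProduct.map LinearMap.id (crossComul delta1 delta2 phi)
      (crossComul delta1 delta2 phi (a ⊗ₜ[k] b)) =
    regroup (omega phi (skp delta1 (delta1 a) ⊗ₜ[k] skp delta2 (delta2 b))) := by
  rw [crossComul_tmul]
  generalize delta1 a = t; revert t; refine pureInd fun a1 a2 => ?_
  simp only [assoc_t, skp_tmul]
  generalize delta2 b = t; revert t; refine pureInd fun b1 b2 => ?_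
  rw [pair2_tmul, right_aux, skp_tmul]
  have h := LinearMap.congr_fun h1 (a2 ⊗ₜ[k] b1)
  simp only [LinearMap.comp_apply, split2_tmul] at h
  rw [h]
  generalize delta1 a2 = t; revert t; refine pureInd fun p q => ?_
  generalize delta2 b2 = t; revert t; refine pureInd fun v w => ?_
  simp only [assoc_t, skp_tmul, pair2_tmul, omega, LinearMap.comp_apply, flat3_tmul]
  generalize phi (q ⊗ₜ[k] b1) = t; revert t; refine pureInd fun f g => ?_
  simp only [assoc_t, skp_tmul, pair2_tmul]
  generalize phi (p ⊗ₜ[k] f) = t; revert t; refine pureInd fun f' g' => ?_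
  simp only [assoc_t, skp_tmul, pair2_tmul, flat3_tmul]

/-- the double multiplication underlying `φ₁₂` -/
noncomputable def mm (m1 : (B1 ⊗[k] B1) →ₗ[k] B1) (m2 : (B2 ⊗[k] B2) →ₗ[k] B2) :
    ((B2 ⊗[k] B1) ⊗[k] (B2 ⊗[k] B1)) →ₗ[k] (B2 ⊗[k] B1) :=
  skp m1 ∘ₗ merge2 m2 ∘ₗ skp swap2 ∘ₗ (TensorProduct.assoc k B2 B1 (B2 ⊗[k] B1)).toLinearMap

theorem mm_tmul (m1 : (B1 ⊗[k] B1) →ₗ[k] B1) (m2 : (B2 ⊗[k] B2) →ₗ[k] B2)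
    (p : B2) (q : B1) (r : B2) (s : B1) :
    mm m1 m2 ((p ⊗ₜ[k] q) ⊗ₜ[k] (r ⊗ₜ[k] s)) = m2 (p ⊗ₜ[k] r) ⊗ₜ[k] m1 (q ⊗ₜ[k] s) := rfl

/-- In the style of Sweedler: `φ₁₂(a ⊗ b) = a₍₋₁₎ b₍₀₎ ⊗ a₍₀₎ b₍₁₎`, i.e. take the product of both
coactions inside the algebra `B₂ ⊗ B₁`. -/
theorem hdPhi12_tmul (hd : HopfDatum k B1 B2) (a : B1) (b : B2) :
    hdPhi12 hd (a ⊗ₜ[k] b) = mm hd.m1 hd.m2 (hd.coactL a ⊗ₜ[k] hd.coactR b) := by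
  simp only [hdPhi12, mpPhi12, mm, LinearMap.comp_apply, split2_tmul, LinearEquiv.coe_coe]
  generalize hd.coactL a = t; revert t; refine pureInd fun p q => ?_
  simp only [assoc_t, skp_tmul]

/-- Elementwise associativity inside the first factor. -/
theorem m1_assoc (hd : HopfDatum k B1 B2) (x y z : B1) :
    hd.m1 (hd.m1 (x ⊗ₜ[k] y) ⊗ₜ[k] z) = hd.m1 (x ⊗ₜ[k] hd.m1 (y ⊗ₜ[k] z)) :=
  LinearMap.congr_fun hd.alg1.mul_assoc ((x ⊗ₜ[k] y) ⊗ₜ[k] z)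

/-- Likewise for the second one. -/
theorem m2_assoc (hd : HopfDatum k B1 B2) (x y z : B2) :
    hd.m2 (hd.m2 (x ⊗ₜ[k] y) ⊗ₜ[k] z) = hd.m2 (x ⊗ₜ[k] hd.m2 (y ⊗ₜ[k] z)) :=
  LinearMap.congr_fun hd.alg2.mul_assoc ((x ⊗ₜ[k] y) ⊗ₜ[k] z)

/-- `(p ⊗ q) ⊗ (c ⊗ d ⊗ e) ↦ pc ⊗ qd ⊗ e` -/
noncomputable def mm3 (hd : HopfDatum k B1 B2) :
    ((B2 ⊗[k] B1) ⊗[k] (B2 ⊗[k] (B1 ⊗[k] B1))) →ₗ[k] (B2 ⊗[k] (B1 ⊗[k] B1)) :=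
  skp (merge2 hd.m1) ∘ₗ merge2 hd.m2 ∘ₗ skp swap2 ∘ₗ
    (TensorProduct.assoc k B2 B1 (B2 ⊗[k] (B1 ⊗[k] B1))).toLinearMap

theorem mm3_tmul (hd : HopfDatum k B1 B2) (p : B2) (q : B1) (c : B2) (d e : B1) :
    mm3 hd ((p ⊗ₜ[k] q) ⊗ₜ[k] (c ⊗ₜ[k] (d ⊗ₜ[k] e))) =
      hd.m2 (p ⊗ₜ[k] c) ⊗ₜ[k] (hd.m1 (q ⊗ₜ[k] d) ⊗ₜ[k] e) := rfl

/-- `(c ⊗ d ⊗ e) ⊗ (p ⊗ q) ↦ c ⊗ dp ⊗ eq` -/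
noncomputable def mm3' (hd : HopfDatum k B1 B2) :
    ((B2 ⊗[k] (B2 ⊗[k] B1)) ⊗[k] (B2 ⊗[k] B1)) →ₗ[k] (B2 ⊗[k] (B2 ⊗[k] B1)) :=
  skp (mm hd.m1 hd.m2) ∘ₗ (TensorProduct.assoc k B2 (B2 ⊗[k] B1) (B2 ⊗[k] B1)).toLinearMap

theorem mm3'_tmul (hd : HopfDatum k B1 B2) (c d : B2) (e : B1) (p : B2) (q : B1) :
    mm3' hd ((c ⊗ₜ[k] (d ⊗ₜ[k] e)) ⊗ₜ[k] (p ⊗ₜ[k] q)) =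
      c ⊗ₜ[k] (hd.m2 (d ⊗ₜ[k] p) ⊗ₜ[k] hd.m1 (e ⊗ₜ[k] q)) := rfl

/-- `(p, q, r, r'; s, t, u) ↦ ps ⊗ q(r ▷ t) ⊗ r'u` -/
noncomputable def psi1 (hd : HopfDatum k B1 B2) :
    ((B2 ⊗[k] (B1 ⊗[k] (B2 ⊗[k] B1))) ⊗[k] (B2 ⊗[k] (B1 ⊗[k] B1))) →ₗ[k]
      (B2 ⊗[k] (B1 ⊗[k] B1)) :=
  skp (skp hd.m1) ∘ₗ skp (merge2 hd.m1) ∘ₗ skp (skp (merge2 hd.actL)) ∘ₗ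
    skp (skp (skp swap2)) ∘ₗ merge2 hd.m2 ∘ₗ skp swap2 ∘ₗ skp (skp swap2) ∘ₗ
    skp (skp (skp swap2)) ∘ₗ
    skp (skp (TensorProduct.assoc k B2 B1 (B2 ⊗[k] (B1 ⊗[k] B1))).toLinearMap) ∘ₗ flat3

theorem psi1_tmul (hd : HopfDatum k B1 B2) (p : B2) (q : B1) (r : B2) (r' : B1)
    (s : B2) (t u : B1) :
    psi1 hd ((p ⊗ₜ[k] (q ⊗ₜ[k] (r ⊗ₜ[k] r'))) ⊗ₜ[k] (s ⊗ₜ[k] (t ⊗ₜ[k] u))) =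
      hd.m2 (p ⊗ₜ[k] s) ⊗ₜ[k]
        (hd.m1 (q ⊗ₜ[k] hd.actL (r ⊗ₜ[k] t)) ⊗ₜ[k] hd.m1 (r' ⊗ₜ[k] u)) := rfl

/-- `(x₁, x₂, w; y, y', y₂, u) ↦ x₁y ⊗ (x₂ ◁ y')y₂ ⊗ wu` -/
noncomputable def psi2 (hd : HopfDatum k B1 B2) :
    ((B2 ⊗[k] (B2 ⊗[k] B1)) ⊗[k] (B2 ⊗[k] (B1 ⊗[k] (B2 ⊗[k] B1)))) →ₗ[k]
      (B2 ⊗[k] (B2 ⊗[k] B1)) :=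
  skp (skp hd.m1) ∘ₗ skp (merge2 hd.m2) ∘ₗ skp (skp swap2) ∘ₗ skp (merge2 hd.actR) ∘ₗ
    skp (skp swap2) ∘ₗ merge2 hd.m2 ∘ₗ skp swap2 ∘ₗ skp (skp swap2) ∘ₗ flat3

theorem psi2_tmul (hd : HopfDatum k B1 B2) (x1 x2 : B2) (w : B1) (y : B2) (y' : B1)
    (y2 : B2) (u : B1) :
    psi2 hd ((x1 ⊗ₜ[k] (x2 ⊗ₜ[k] w)) ⊗ₜ[k] (y ⊗ₜ[k] (y' ⊗ₜ[k] (y2 ⊗ₜ[k] u)))) =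
      hd.m2 (x1 ⊗ₜ[k] y) ⊗ₜ[k]
        (hd.m2 (hd.actR (x2 ⊗ₜ[k] y') ⊗ₜ[k] y2) ⊗ₜ[k] hd.m1 (w ⊗ₜ[k] u)) := rfl

/-- left-hand side of the first compatibility -/
theorem c1_left (hd : HopfDatum k B1 B2) (x y : B2 ⊗[k] B1) :
    skp hd.delta1 (mm hd.m1 hd.m2 (x ⊗ₜ[k] y)) =
      psi1 hd (skp (skp hd.coactL) (skp hd.delta1 x) ⊗ₜ[k] skp hd.delta1 y) := by
  revert x; refine pureInd fun p q => ?_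
  revert y; refine pureInd fun s t => ?_
  have h := LinearMap.congr_fun hd.algCoalg1 (q ⊗ₜ[k] t)
  simp only [LinearMap.comp_apply, split2_tmul] at h
  simp only [mm_tmul, skp_tmul, h]
  generalize hd.delta1 q = t; revert t; refine pureInd fun q1 q2 => ?_
  simp only [assoc_t, skp_tmul]
  generalize hd.delta1 t = t; revert t; refine pureInd fun t1 t2 => ?_
  simp only [assoc_t, skp_tmul, split2_tmul]
  generalize hd.coactL q2 = t; revert t; refine pureInd fun r r' => ?_
  simp only [assoc_t, skp_tmul, swap2_tmul, merge2_tmul, psi1_tmul]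

/-- The comodule-algebra axiom, packaged for use under `φ₁₂`: how the right coaction sees a product
of two elements from `B₂ ⊗ B₁`. Only the `B₂`-letters matter, whereas `w` and `u` are spectators. -/
theorem c1_q (hd : HopfDatum k B1 B2) (z y : B2 ⊗[k] B1) :
    split2 hd.coactR (mm hd.m1 hd.m2 (z ⊗ₜ[k] y)) =
      psi1 hd (split2 hd.coactR (split2 hd.delta2 z) ⊗ₜ[k] split2 hd.coactR y) := by
  revert z; refine pureInd fun v w => ?_
  revert y; refine pureInd fun s u => ?_
  have h := LinearMap.congr_fun hd.comodAlg1 (v ⊗ₜ[k] s)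
  simp only [LinearMap.comp_apply, split2_tmul] at h
  simp only [mm_tmul, split2_tmul, h]
  generalize hd.delta2 v = t; revert t; refine pureInd fun v1 v2 => ?_
  simp only [assoc_t, skp_tmul, split2_tmul]
  generalize hd.coactR v1 = t; revert t; refine pureInd fun c d => ?_
  simp only [assoc_t, skp_tmul, split2_tmul]
  generalize hd.coactR s = t; revert t; refine pureInd fun s0 s1 => ?_
  simp only [assoc_t, skp_tmul, swap2_tmul, merge2_tmul, psi1_tmul]

/-- Crossing a fixed letter `a` past a word `w` amounts to multiplying with its left coaction, after
`w` has been opened up by the right coaction. -/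
theorem c1_pair (hd : HopfDatum k B1 B2) (a : B1) (w : B2 ⊗[k] B1) :
    pair2 (hdPhi12 hd) (a ⊗ₜ[k] w) = mm3 hd (hd.coactL a ⊗ₜ[k] split2 hd.coactR w) := by
  revert w; refine pureInd fun c e => ?_
  simp only [pair2_tmul, hdPhi12_tmul, split2_tmul]
  generalize hd.coactL a = t; revert t; refine pureInd fun p q => ?_
  generalize hd.coactR c = t; revert t; refine pureInd fun c d => ?_
  simp only [assoc_t, mm_tmul, mm3_tmul]

/-- The bookkeeping heart of the first sliding law. Both expressions multiply identical letters, merely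
grouped in another way, so that associativity of `m₁` and `m₂` settles the matter. No compatibility
axiom enters here. -/
theorem c1_final (hd : HopfDatum k B1 B2) (x z : B2 ⊗[k] B1) (y : B2 ⊗[k] (B1 ⊗[k] B1)) :
    mm3 hd (x ⊗ₜ[k] psi1 hd (split2 hd.coactR (skp hd.coactL z) ⊗ₜ[k] y)) =
      psi1 hd (skp (skp hd.coactL) (mm3 hd (x ⊗ₜ[k] split2 hd.coactR z)) ⊗ₜ[k] y) := by
  revert x; refine pureInd fun p q => ?_
  revert z; refine pureInd fun v w => ?_
  simp only [split2_tmul, skp_tmul]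
  generalize hd.coactR v = t; revert t; refine pureInd fun c d => ?_
  simp only [assoc_t, mm3_tmul, skp_tmul]
  generalize hd.coactL w = t; revert t; refine pureInd fun e f => ?_
  revert y; refine pureInd fun s y' => ?_
  revert y'; refine pureInd fun t u => ?_
  simp only [psi1_tmul, mm3_tmul, m1_assoc, m2_assoc]

/-- First sliding law: comultiplying the `B₁`-output of `φ₁₂` equals comultiplying its input and then
crossing twice. Ingredients: `algCoalg1` (through `c1_left`), coassociativity of either coaction,
the comodule-coalgebra identity `comodCoalg2`, and `comodAlg1` (through `c1_q`). -/
theorem c1 (hd : HopfDatum k B1 B2) :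
    skp hd.delta1 ∘ₗ hdPhi12 hd =
      pair2 (hdPhi12 hd) ∘ₗ skp (hdPhi12 hd) ∘ₗ split2 hd.delta1 := by
  apply TensorProduct.ext'
  intro a b
  have hR : skp hd.delta1 (hd.coactR b) = split2 hd.coactR (hd.coactR b) :=
    (LinearMap.congr_fun hd.coactR_coact b).symm
  have hC := LinearMap.congr_fun hd.comodCoalg2 a
  simp only [LinearMap.comp_apply] at hC
  simp only [LinearMap.comp_apply, hdPhi12_tmul, c1_left, hR, hC, split2_tmul]
  generalize hd.delta1 a = t; revert t; refine pureInd fun a1 a2 => ?_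
  have hL : split2 hd.delta2 (hd.coactL a2) = skp hd.coactL (hd.coactL a2) :=
    LinearMap.congr_fun hd.coactL_coact a2
  simp only [assoc_t, skp_tmul, hdPhi12_tmul, c1_pair, c1_q, hL, c1_final, split2_tmul]
  congr 3
  generalize hd.coactL a1 = t; revert t; refine pureInd fun p q => ?_
  simp only [assoc_t, skp_tmul]
  generalize hd.coactL a2 = t; revert t; refine pureInd fun v w => ?_
  simp only [split2_tmul]
  generalize hd.coactR v = t; revert t; refine pureInd fun c d => ?_
  simp only [assoc_t, skp_tmul, swap2_tmul, merge2_tmul, mm3_tmul]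

/-- left-hand side of the second compatibility -/
theorem c2_left (hd : HopfDatum k B1 B2) (x y : B2 ⊗[k] B1) :
    split2 hd.delta2 (mm hd.m1 hd.m2 (x ⊗ₜ[k] y)) =
      psi2 hd (split2 hd.delta2 x ⊗ₜ[k] split2 hd.coactR (split2 hd.delta2 y)) := by
  revert x; refine pureInd fun p q => ?_
  revert y; refine pureInd fun s t => ?_
  have h := LinearMap.congr_fun hd.algCoalg2 (p ⊗ₜ[k] s)
  simp only [LinearMap.comp_apply, split2_tmul] at h
  simp only [mm_tmul, split2_tmul, h]
  generalize hd.delta2 p = t; revert t; refine pureInd fun x1 x2 => ?_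
  simp only [assoc_t, skp_tmul]
  generalize hd.delta2 s = t; revert t; refine pureInd fun y1 y2 => ?_
  simp only [assoc_t, skp_tmul, split2_tmul]
  generalize hd.coactR y1 = t; revert t; refine pureInd fun r r' => ?_
  simp only [assoc_t, skp_tmul, swap2_tmul, merge2_tmul, psi2_tmul]

/-- The comodule-algebra axiom for the left coaction, counterpart to `c1_q`; this time letters from
`B₁` interact while those in `B₂` just watch. -/
theorem c2_q (hd : HopfDatum k B1 B2) (x y : B2 ⊗[k] B1) :
    skp hd.coactL (mm hd.m1 hd.m2 (x ⊗ₜ[k] y)) =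
      psi2 hd (skp hd.coactL x ⊗ₜ[k] skp (skp hd.coactL) (skp hd.delta1 y)) := by
  revert x; refine pureInd fun c d => ?_
  revert y; refine pureInd fun e f => ?_
  have h := LinearMap.congr_fun hd.comodAlg2 (d ⊗ₜ[k] f)
  simp only [LinearMap.comp_apply, split2_tmul] at h
  simp only [mm_tmul, skp_tmul, h]
  generalize hd.coactL d = t; revert t; refine pureInd fun v w => ?_
  simp only [assoc_t, skp_tmul]
  generalize hd.delta1 f = t; revert t; refine pureInd fun f1 f2 => ?_
  simp only [assoc_t, skp_tmul, swap2_tmul, merge2_tmul]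
  generalize hd.coactL f2 = t; revert t; refine pureInd fun s0 s1 => ?_
  simp only [assoc_t, skp_tmul, swap2_tmul, merge2_tmul, psi2_tmul]

/-- Crossing a word `w` past the letter `b` situated at its end, the analogue of `c1_pair`. Since `b` is
the last letter nothing has to be re-bracketed, and after evaluation it holds by definition. -/
theorem c2_pair (hd : HopfDatum k B1 B2) (w : B2 ⊗[k] B1) (b : B2) :
    skp (hdPhi12 hd) (TensorProduct.assoc k B2 B1 B2 (w ⊗ₜ[k] b)) =
      mm3' hd (skp hd.coactL w ⊗ₜ[k] hd.coactR b) := by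
  revert w; refine pureInd fun c e => ?_
  simp only [assoc_t, skp_tmul, hdPhi12_tmul]
  rfl

/-- Regrouping step of the second sliding law, once more a consequence of associativity only. The
auxiliary fact `e'` says that coacting upon the first letter commutes with multiplying the others. -/
theorem c2_final (hd : HopfDatum k B1 B2) (x : B2 ⊗[k] (B2 ⊗[k] B1)) (y z : B2 ⊗[k] B1) :
    mm3' hd (psi2 hd (x ⊗ₜ[k] skp (skp hd.coactL) (split2 hd.coactR y)) ⊗ₜ[k] z) =
      psi2 hd (x ⊗ₜ[k] split2 hd.coactR (mm3' hd (skp hd.coactL y ⊗ₜ[k] z))) := by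
  revert y; refine pureInd fun e f => ?_
  revert z; refine pureInd fun p q => ?_
  revert x; refine pureInd fun x1 x' => ?_
  revert x'; refine pureInd fun x2 w => ?_
  simp only [split2_tmul, skp_tmul]
  have e' : ∀ s : B2 ⊗[k] B1,
      split2 hd.coactR (mm3' hd ((e ⊗ₜ[k] s) ⊗ₜ[k] (p ⊗ₜ[k] q))) =
        TensorProduct.assoc k B2 B1 _
          (hd.coactR e ⊗ₜ[k] mm hd.m1 hd.m2 (s ⊗ₜ[k] (p ⊗ₜ[k] q))) := by
    intro s
    revert s; refine pureInd fun i j => ?_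
    simp only [mm3'_tmul, mm_tmul, split2_tmul]
  rw [e']
  generalize hd.coactR e = t; revert t; refine pureInd fun s t => ?_
  simp only [assoc_t, skp_tmul]
  generalize hd.coactL f = t; revert t; refine pureInd fun g h => ?_
  simp only [mm_tmul, psi2_tmul, mm3'_tmul, m1_assoc, m2_assoc]

/-- Second sliding law: the `B₂`-output may be comultiplied before or after crossing. It relies on
`algCoalg2`, `comodCoalg1`, `comodAlg2`, plus coassociativity for the two coactions. -/
theorem c2 (hd : HopfDatum k B1 B2) :
    split2 hd.delta2 ∘ₗ hdPhi12 hd =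
      skp (hdPhi12 hd) ∘ₗ pair2 (hdPhi12 hd) ∘ₗ skp hd.delta2 := by
  apply TensorProduct.ext'
  intro a b
  have hL : split2 hd.delta2 (hd.coactL a) = skp hd.coactL (hd.coactL a) :=
    LinearMap.congr_fun hd.coactL_coact a
  have hC := LinearMap.congr_fun hd.comodCoalg1 b
  simp only [LinearMap.comp_apply] at hC
  simp only [LinearMap.comp_apply, hdPhi12_tmul, c2_left, hL, hC, skp_tmul]
  generalize hd.delta2 b = t; revert t; refine pureInd fun b1 b2 => ?_
  have hR : skp hd.delta1 (hd.coactR b1) = split2 hd.coactR (hd.coactR b1) :=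
    (LinearMap.congr_fun hd.coactR_coact b1).symm
  simp only [pair2_tmul, hdPhi12_tmul, c2_pair, c2_q, hR, c2_final, split2_tmul]
  congr 3
  generalize hd.coactR b1 = t; revert t; refine pureInd fun p q => ?_
  simp only [assoc_t, skp_tmul, split2_tmul]
  generalize hd.coactL q = t; revert t; refine pureInd fun v w => ?_
  simp only [assoc_t, skp_tmul]
  generalize hd.coactR b2 = t; revert t; refine pureInd fun c d => ?_
  simp only [assoc_t, skp_tmul, swap2_tmul, merge2_tmul, mm3'_tmul]

/-- Multiplicativity of the counit `ε₂`. This is not listed among the axioms. We recover it by letting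
a product act upon the unit of `B₁`, where the action degenerates to `ε₂`, before projecting back to
scalars thanks to `ε₁ η₁ = 1`. -/
theorem eps2_mul (hd : HopfDatum k B1 B2) (x y : B2) :
    hd.eps2 (hd.m2 (x ⊗ₜ[k] y)) = hd.eps2 x * hd.eps2 y := by
  have hu : ∀ b : B2, hd.actL (b ⊗ₜ[k] hd.eta1 1) = hd.eta1 (hd.eps2 b) :=
    fun b => LinearMap.congr_fun hd.actL_eta1 b
  have he : ∀ c : k, hd.eps1 (hd.eta1 c) = c := fun c => LinearMap.congr_fun hd.epseta1 c
  have ha : hd.actL (hd.m2 (x ⊗ₜ[k] y) ⊗ₜ[k] hd.eta1 1) =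
      hd.actL (x ⊗ₜ[k] hd.actL (y ⊗ₜ[k] hd.eta1 1)) :=
    LinearMap.congr_fun hd.actL_act (x ⊗ₜ[k] (y ⊗ₜ[k] hd.eta1 1))
  have hs : hd.eta1 (hd.eps2 y) = hd.eps2 y • hd.eta1 1 := by
    rw [← map_smul, smul_eq_mul, mul_one]
  rw [hu, hu, hs, tmul_smul, map_smul, hu] at ha
  have := congrArg hd.eps1 ha
  rw [map_smul, he, he, smul_eq_mul, mul_comm] at this
  exact this

/-- Multiplicativity of `ε₁`, obtained similarly from the trivial right action on the unit of `B₂`. -/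
theorem eps1_mul (hd : HopfDatum k B1 B2) (x y : B1) :
    hd.eps1 (hd.m1 (x ⊗ₜ[k] y)) = hd.eps1 x * hd.eps1 y := by
  have hu : ∀ b : B1, hd.actR (hd.eta2 1 ⊗ₜ[k] b) = hd.eta2 (hd.eps1 b) :=
    fun b => LinearMap.congr_fun hd.actR_eta2 b
  have he : ∀ c : k, hd.eps2 (hd.eta2 c) = c := fun c => LinearMap.congr_fun hd.epseta2 c
  have ha : hd.actR (hd.eta2 1 ⊗ₜ[k] hd.m1 (x ⊗ₜ[k] y)) =
      hd.actR (hd.actR (hd.eta2 1 ⊗ₜ[k] x) ⊗ₜ[k] y) :=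
    LinearMap.congr_fun hd.actR_act (hd.eta2 1 ⊗ₜ[k] (x ⊗ₜ[k] y))
  have hs : hd.eta2 (hd.eps1 x) = hd.eps1 x • hd.eta2 1 := by
    rw [← map_smul, smul_eq_mul, mul_one]
  rw [hu, hu, hs, ← smul_tmul', map_smul, hu] at ha
  have := congrArg hd.eps2 ha
  rw [map_smul, he, he, smul_eq_mul] at this
  exact this

/-- `(ε₂ ⊗ id) φ₁₂ = id ⊗ ε₂` -/
theorem phi_eps2 (hd : HopfDatum k B1 B2) (a : B1) (b : B2) :
    TensorProduct.lid k B1 (TensorProduct.map hd.eps2 LinearMap.id (hdPhi12 hd (a ⊗ₜ[k] b))) =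
      hd.eps2 b • a := by
  have hL : TensorProduct.lid k B1 (TensorProduct.map hd.eps2 LinearMap.id (hd.coactL a)) = a :=
    LinearMap.congr_fun hd.coactL_counit a
  have hR : TensorProduct.lid k B1 (TensorProduct.map hd.eps2 LinearMap.id (hd.coactR b)) =
      hd.eta1 (hd.eps2 b) := LinearMap.congr_fun hd.coactR_eps2 b
  have hone : hd.m1 (a ⊗ₜ[k] hd.eta1 1) = a := LinearMap.congr_fun hd.alg1.mul_one a
  have key : ∀ x y : B2 ⊗[k] B1,
      TensorProduct.lid k B1 (TensorProduct.map hd.eps2 LinearMap.id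
        (mm hd.m1 hd.m2 (x ⊗ₜ[k] y))) =
      hd.m1 (TensorProduct.lid k B1 (TensorProduct.map hd.eps2 LinearMap.id x) ⊗ₜ[k]
        TensorProduct.lid k B1 (TensorProduct.map hd.eps2 LinearMap.id y)) := by
    intro x y
    revert x; refine pureInd fun p q => ?_
    revert y; refine pureInd fun s t => ?_
    simp only [mm_tmul, TensorProduct.map_tmul, TensorProduct.lid_tmul, eps2_mul,
      LinearMap.id_apply, tmul_smul, ← smul_tmul', map_smul, smul_smul, mul_comm]
  have hs : hd.eta1 (hd.eps2 b) = hd.eps2 b • hd.eta1 1 := by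
    rw [← map_smul, smul_eq_mul, mul_one]
  rw [hdPhi12_tmul, key, hL, hR, hs, tmul_smul, map_smul, hone]

/-- `(id ⊗ ε₁) φ₁₂ = ε₁ ⊗ id` -/
theorem phi_eps1 (hd : HopfDatum k B1 B2) (a : B1) (b : B2) :
    TensorProduct.rid k B2 (TensorProduct.map LinearMap.id hd.eps1 (hdPhi12 hd (a ⊗ₜ[k] b))) =
      hd.eps1 a • b := by
  have hR : TensorProduct.rid k B2 (TensorProduct.map LinearMap.id hd.eps1 (hd.coactR b)) = b :=
    LinearMap.congr_fun hd.coactR_counit b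
  have hL : TensorProduct.rid k B2 (TensorProduct.map LinearMap.id hd.eps1 (hd.coactL a)) =
      hd.eta2 (hd.eps1 a) := LinearMap.congr_fun hd.coactL_eps1 a
  have hone : hd.m2 (hd.eta2 1 ⊗ₜ[k] b) = b := LinearMap.congr_fun hd.alg2.one_mul b
  have key : ∀ x y : B2 ⊗[k] B1,
      TensorProduct.rid k B2 (TensorProduct.map LinearMap.id hd.eps1
        (mm hd.m1 hd.m2 (x ⊗ₜ[k] y))) =
      hd.m2 (TensorProduct.rid k B2 (TensorProduct.map LinearMap.id hd.eps1 x) ⊗ₜ[k]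
        TensorProduct.rid k B2 (TensorProduct.map LinearMap.id hd.eps1 y)) := by
    intro x y
    revert x; refine pureInd fun p q => ?_
    revert y; refine pureInd fun s t => ?_
    simp only [mm_tmul, TensorProduct.map_tmul, TensorProduct.rid_tmul, eps1_mul,
      LinearMap.id_apply, tmul_smul, ← smul_tmul', map_smul, smul_smul, mul_comm]
  have hs : hd.eta2 (hd.eps1 a) = hd.eps1 a • hd.eta2 1 := by
    rw [← map_smul, smul_eq_mul, mul_one]
  rw [hdPhi12_tmul, key, hL, hR, hs, ← smul_tmul', map_smul, hone]

/-- Contracting the first output pair with `ε₁ ⊗ ε₂` for an abstract middle pair `u`. -/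
theorem counit_left_aux (eps1 : B1 →ₗ[k] k) (eps2 : B2 →ₗ[k] k) (a1 : B1) (b2 : B2)
    (u : B2 ⊗[k] B1) :
    TensorProduct.lid k (B1 ⊗[k] B2) (TensorProduct.map (crossCounit eps1 eps2) LinearMap.id
      ((TensorProduct.assoc k B1 B2 (B1 ⊗[k] B2)).symm
        (a1 ⊗ₜ[k] TensorProduct.assoc k B2 B1 B2 (u ⊗ₜ[k] b2)))) =
    eps1 a1 • (TensorProduct.lid k B1 (TensorProduct.map eps2 LinearMap.id u) ⊗ₜ[k] b2) := by
  revert u; refine pureInd fun c d => ?_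
  simp only [assoc_t, assoc_symm_t, TensorProduct.map_tmul, TensorProduct.lid_tmul,
    LinearMap.id_apply, crossCounit, LinearMap.comp_apply, LinearMap.mul'_apply, ← smul_tmul',
    smul_smul]

/-- Contracting the last output pair; compare `counit_left_aux`. -/
theorem counit_right_aux (eps1 : B1 →ₗ[k] k) (eps2 : B2 →ₗ[k] k) (a1 : B1) (b2 : B2)
    (u : B2 ⊗[k] B1) :
    TensorProduct.rid k (B1 ⊗[k] B2) (TensorProduct.map LinearMap.id (crossCounit eps1 eps2)
      ((TensorProduct.assoc k B1 B2 (B1 ⊗[k] B2)).symm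
        (a1 ⊗ₜ[k] TensorProduct.assoc k B2 B1 B2 (u ⊗ₜ[k] b2)))) =
    eps2 b2 • (a1 ⊗ₜ[k] TensorProduct.rid k B2 (TensorProduct.map LinearMap.id eps1 u)) := by
  revert u; refine pureInd fun c d => ?_
  simp only [assoc_t, assoc_symm_t, TensorProduct.map_tmul, TensorProduct.rid_tmul,
    LinearMap.id_apply, crossCounit, LinearMap.comp_apply, LinearMap.mul'_apply, tmul_smul,
    smul_smul, mul_comm]

/-- By `phi_eps2` the crossing disappears once its `B₂`-output gets contracted, so the left counit
expression factorises into those belonging to `B₁` and `B₂`. -/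
theorem counit_left_eq (hd : HopfDatum k B1 B2) (a : B1) (b : B2) :
    TensorProduct.lid k (B1 ⊗[k] B2) (TensorProduct.map (crossCounit hd.eps1 hd.eps2)
      LinearMap.id (crossComul hd.delta1 hd.delta2 (hdPhi12 hd) (a ⊗ₜ[k] b))) =
    TensorProduct.lid k B1 (TensorProduct.map hd.eps1 LinearMap.id (hd.delta1 a)) ⊗ₜ[k]
      TensorProduct.lid k B2 (TensorProduct.map hd.eps2 LinearMap.id (hd.delta2 b)) := by
  rw [crossComul_tmul]
  generalize hd.delta1 a = t; revert t; refine pureInd fun a1 a2 => ?_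
  simp only [assoc_t, skp_tmul]
  generalize hd.delta2 b = t; revert t; refine pureInd fun b1 b2 => ?_
  rw [pair2_tmul, counit_left_aux, phi_eps2]
  simp only [TensorProduct.map_tmul, TensorProduct.lid_tmul, LinearMap.id_apply, tmul_smul,
    ← smul_tmul', smul_smul, mul_comm]

/-- Factorisation of the right counit expression, this time using `phi_eps1`. -/
theorem counit_right_eq (hd : HopfDatum k B1 B2) (a : B1) (b : B2) :
    TensorProduct.rid k (B1 ⊗[k] B2) (TensorProduct.map LinearMap.id
      (crossCounit hd.eps1 hd.eps2)
      (crossComul hd.delta1 hd.delta2 (hdPhi12 hd) (a ⊗ₜ[k] b))) =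
    TensorProduct.rid k B1 (TensorProduct.map LinearMap.id hd.eps1 (hd.delta1 a)) ⊗ₜ[k]
      TensorProduct.rid k B2 (TensorProduct.map LinearMap.id hd.eps2 (hd.delta2 b)) := by
  rw [crossComul_tmul]
  generalize hd.delta1 a = t; revert t; refine pureInd fun a1 a2 => ?_
  simp only [assoc_t, skp_tmul]
  generalize hd.delta2 b = t; revert t; refine pureInd fun b1 b2 => ?_
  rw [pair2_tmul, counit_right_aux, phi_eps1]
  simp only [TensorProduct.map_tmul, TensorProduct.rid_tmul, LinearMap.id_apply, tmul_smul,
    ← smul_tmul', smul_smul, mul_comm]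

/-- Everything put together: coassociativity arises by comparing `left_side` with `right_side`, while
both counit laws follow from the factorisations above. -/
theorem final_proof (hd : HopfDatum k B1 B2) :
    IsCoalgMaps k (B1 ⊗[k] B2) (crossComul hd.delta1 hd.delta2 (hdPhi12 hd))
      (crossCounit hd.eps1 hd.eps2) := by
  refine ⟨?_, ?_, ?_⟩
  · apply TensorProduct.ext'
    intro a b
    have e1 : split2 hd.delta1 (hd.delta1 a) = skp hd.delta1 (hd.delta1 a) :=
      LinearMap.congr_fun hd.coalg1.coassoc a
    have e2 : split2 hd.delta2 (hd.delta2 b) = skp hd.delta2 (hd.delta2 b) :=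
      LinearMap.congr_fun hd.coalg2.coassoc b
    refine (left_side _ _ _ (c2 hd) a b).trans ?_
    rw [e1, e2]
    exact (right_side _ _ _ (c1 hd) a b).symm
  · apply TensorProduct.ext'
    intro a b
    have e1 : TensorProduct.lid k B1 (TensorProduct.map hd.eps1 LinearMap.id (hd.delta1 a)) = a :=
      LinearMap.congr_fun hd.coalg1.counit_left a
    have e2 : TensorProduct.lid k B2 (TensorProduct.map hd.eps2 LinearMap.id (hd.delta2 b)) = b :=
      LinearMap.congr_fun hd.coalg2.counit_left b
    refine (counit_left_eq hd a b).trans ?_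
    rw [e1, e2]
    rfl
  · apply TensorProduct.ext'
    intro a b
    have e1 : TensorProduct.rid k B1 (TensorProduct.map LinearMap.id hd.eps1 (hd.delta1 a)) = a :=
      LinearMap.congr_fun hd.coalg1.counit_right a
    have e2 : TensorProduct.rid k B2 (TensorProduct.map LinearMap.id hd.eps2 (hd.delta2 b)) = b :=
      LinearMap.congr_fun hd.coalg2.counit_right b
    refine (counit_right_eq hd a b).trans ?_
    rw [e1, e2]
    rfl

end Main
end CPB

namespace CPB

variable {k : Type*} [CommRing k] {B1 B2 : Type*}
  [AddCommMonoid B1] [Module k B1] [AddCommMonoid B2] [Module k B2]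

/-- Proposition 2.6, coalgebra part: for a Hopf datum `(B₁, B₂, μ_l, ν_l, μ_r, ν_r)`,
the tensor product `B₁ ⊗ B₂` with comultiplication
`(id ⊗ φ₁₂ ⊗ id) ∘ (Δ₁ ⊗ Δ₂)`, `φ₁₂ = (m₂ ⊗ m₁) ∘ (id ⊗ τ ⊗ id) ∘ (ν_l ⊗ ν_r)`,
and counit `ε₁ ⊗ ε₂` is a coassociative counital coalgebra. -/
theorem hopfDatum_coalgebra (hd : HopfDatum k B1 B2) :
    IsCoalgMaps k (B1 ⊗[k] B2) (crossComul hd.delta1 hd.delta2 (hdPhi12 hd))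
      (crossCounit hd.eps1 hd.eps2) := by
  exact final_proof hd

end CPB
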